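/- arXiv:2309.11481 — 9 statements merged into one kernel-verified Lean document; each statement's English description precedes it below -/
import Mathlib

section
/- Let 0 < μ ≤ L and let S ⊆ [μ, L] be a finite set with μ ∈ S and L ∈ S. Assume that for every λ ∈ S both complex roots of the polynomial z² + b_λ·z + c_λ have modulus strictly less than 1. Then r_μ > 0, r_L > 0, and sup_{ω ∈ ℝ} max_{λ ∈ S} h_ω(λ) = (α²/2)·max(μ/r_μ², L/r_L²). (This supremum is the squared H∞ norm, equivalently the squared ℓ2 gain from gradient errors to suboptimality, of the GMM system applied to a strongly convex quadratic whose Hessian has eigenvalue set S.) -/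
/-- `b_λ := αλ(1+ν) − (1+β)`. -/
noncomputable def bCoef (α β ν lam : ℝ) : ℝ := α * lam * (1 + ν) - (1 + β)

/-- `c_λ := β − αλν`. -/
noncomputable def cCoef (α β ν lam : ℝ) : ℝ := β - α * lam * ν

/-- `r_λ` as in Theorem `thm-h-inf`. -/
noncomputable def rCoef (α β ν lam : ℝ) : ℝ :=
  if 0 < cCoef α β ν lam ∧
      |bCoef α β ν lam| * (1 + cCoef α β ν lam) / (4 * cCoef α β ν lam) < 1 then
    |1 - cCoef α β ν lam| * Real.sqrt (1 - (bCoef α β ν lam) ^ 2 / (4 * cCoef α β ν lam))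
  else
    |(|1 + cCoef α β ν lam| - |bCoef α β ν lam|)|

/-- `h_ω(λ) := α²λ / (2·|e^{2iω} + b_λ e^{iω} + c_λ|²)`. -/
noncomputable def hFun (α β ν ω lam : ℝ) : ℝ :=
  α ^ 2 * lam /
    (2 * ‖Complex.exp (2 * ω * Complex.I) +
      (bCoef α β ν lam : ℂ) * Complex.exp (ω * Complex.I) + (cCoef α β ν lam : ℂ)‖ ^ 2)


lemma aux_quart (a0 a1 a2 a3 a4 x y z : ℝ) (h0 : 0 ≤ a0) (h4 : 0 ≤ a4)
    (h32 : 0 < a3 → 0 ≤ a2) (hx : 0 < x) (hxy : x ≤ y) (hyz : y ≤ z)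
    (Rx : 0 ≤ -a4 * x ^ 4 + a3 * x ^ 3 + a2 * x ^ 2 + a1 * x - a0)
    (Rz : 0 ≤ -a4 * z ^ 4 + a3 * z ^ 3 + a2 * z ^ 2 + a1 * z - a0) :
    0 ≤ -a4 * y ^ 4 + a3 * y ^ 3 + a2 * y ^ 2 + a1 * y - a0 := by
  rcases eq_or_lt_of_le hxy with rfl | hxy
  · exact Rx
  obtain ⟨p, hp, rfl⟩ : ∃ p, 0 < p ∧ y = x + p := ⟨y - x, by linarith, by ring⟩
  obtain ⟨q, hq, rfl⟩ : ∃ q, 0 ≤ q ∧ z = x + p + q := ⟨z - (x + p), by linarith, by ring⟩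
  rcases le_or_gt a3 0 with h3 | h3
  · obtain ⟨a3, rfl⟩ : ∃ a, a3 = -a := ⟨-a3, by ring⟩
    have h3 : 0 ≤ a3 := by linarith
    have key : (-a4 * (x+p) ^ 4 + -a3 * (x+p) ^ 3 + a2 * (x+p) ^ 2 + a1 * (x+p) - a0)
        * (x * (x+p+q) * (p + q)) =
        (-a4 * x ^ 4 + -a3 * x ^ 3 + a2 * x ^ 2 + a1 * x - a0) * ((x+p)*(x+p+q)*q)
        + (-a4 * (x+p+q) ^ 4 + -a3 * (x+p+q) ^ 3 + a2 * (x+p+q) ^ 2 + a1 * (x+p+q) - a0)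
          * ((x+p)*x*p)
        + a4 * (x*(x+p)*(x+p+q)) * (p*q*(p+q)*(3*x+2*p+q))
        + a3 * (x*(x+p)*(x+p+q)) * (p*q*(p+q))
        + a0 * (p*q*(p+q)) := by ring
    have hpos : 0 < x * (x+p+q) * (p + q) := by positivity
    refine nonneg_of_mul_nonneg_left ?_ hpos
    rw [key]
    have := mul_nonneg Rx (show 0 ≤ (x+p)*(x+p+q)*q by positivity)
    have := mul_nonneg Rz (show 0 ≤ (x+p)*x*p by positivity)
    positivity
  have h2 := h32 h3
  rcases le_or_gt a1 0 with h1 | h1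
  · obtain ⟨a1, rfl⟩ : ∃ a, a1 = -a := ⟨-a1, by ring⟩
    have h1 : 0 ≤ a1 := by linarith
    have key : (-a4 * (x+p) ^ 4 + a3 * (x+p) ^ 3 + a2 * (x+p) ^ 2 + -a1 * (x+p) - a0)
        * (x^2 * (x+p+q)^2 * (p + q)) =
        (-a4 * x ^ 4 + a3 * x ^ 3 + a2 * x ^ 2 + -a1 * x - a0) * ((x+p)^2*(x+p+q)^2*q)
        + (-a4 * (x+p+q) ^ 4 + a3 * (x+p+q) ^ 3 + a2 * (x+p+q) ^ 2 + -a1 * (x+p+q) - a0)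
          * ((x+p)^2*x^2*p)
        + a4 * (x^2*(x+p)^2*(x+p+q)^2) * (p*q*(p+q))
        + a1 * (x*(x+p)*(x+p+q)) * (p*q*(p+q))
        + a0 * (p*q*(p+q)) * ((x+p)*(x+p+q) + x*(x+p) + x*(x+p+q)) := by ring
    have hpos : 0 < x^2 * (x+p+q)^2 * (p + q) := by positivity
    refine nonneg_of_mul_nonneg_left ?_ hpos
    rw [key]
    have := mul_nonneg Rx (show 0 ≤ (x+p)^2*(x+p+q)^2*q by positivity)
    have := mul_nonneg Rz (show 0 ≤ (x+p)^2*x^2*p by positivity)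
    positivity
  · have hA : 0 ≤ (x+p+q)^4 - (x+p)^4 := by
      have : (x+p+q)^4 - (x+p)^4 = q*(2*x+2*p+q)*((x+p+q)^2+(x+p)^2) := by ring
      rw [this]; positivity
    have hB : 0 ≤ (x+p)^4 - x^4 := by
      have : (x+p)^4 - x^4 = p*(2*x+p)*((x+p)^2+x^2) := by ring
      rw [this]; positivity
    have hC : 0 < (x+p+q)^4 - x^4 := by
      have : (x+p+q)^4 - x^4 = (p+q)*(2*x+p+q)*((x+p+q)^2+x^2) := by ring
      rw [this]; positivity
    have e1 : 0 ≤ (x+p)*((x+p+q)^4 - x^4) - x*((x+p+q)^4 - (x+p)^4)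
        - (x+p+q)*((x+p)^4 - x^4) := by ring_nf; positivity
    have e2 : 0 ≤ (x+p)^2*((x+p+q)^4 - x^4) - x^2*((x+p+q)^4 - (x+p)^4)
        - (x+p+q)^2*((x+p)^4 - x^4) := by ring_nf; positivity
    have e3 : 0 ≤ (x+p)^3*((x+p+q)^4 - x^4) - x^3*((x+p+q)^4 - (x+p)^4)
        - (x+p+q)^3*((x+p)^4 - x^4) := by ring_nf; positivity
    refine nonneg_of_mul_nonneg_left ?_ hC
    have f1 := mul_nonneg Rx hA
    have f2 := mul_nonneg Rz hB
    have g1 := mul_nonneg h1.le e1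
    have g2 := mul_nonneg h2 e2
    have g3 := mul_nonneg h3.le e3
    linarith

lemma aux_poly (s ν u0 x y z : ℝ) (hs : 0 ≤ s) (hν : 0 ≤ ν) (hx : 0 < x) (hxy : x ≤ y)
    (hyz : y ≤ z) (hu : 0 < u0 + ν * x)
    (Rx : 0 ≤ (u0 + ν*x)^2*(4*x-(x+(u0+ν*x))^2) - 4*s*x*(1-(u0+ν*x)))
    (Rz : 0 ≤ (u0 + ν*z)^2*(4*z-(z+(u0+ν*z))^2) - 4*s*z*(1-(u0+ν*z))) :
    0 ≤ (u0 + ν*y)^2*(4*y-(y+(u0+ν*y))^2) - 4*s*y*(1-(u0+ν*y)) := by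
  rcases le_or_gt 0 u0 with h0 | h0
  · have := aux_quart (u0^4) (-2*ν*u0^3 + u0^2*(4-2*(1+ν)*u0) - 4*s*(1-u0))
      (4*s*ν + u0*(4*(ν*(2-(1+ν)*u0)-u0*(1+ν)^2) + u0*(4*(1+ν)^2-ν^2-(1+ν)^2)))
      (2*ν*(ν*(2-(1+ν)*u0)-u0*(1+ν)^2)) (ν^2*(1+ν)^2) x y z (by positivity) (by positivity)
      (by
        intro h
        have h' : 0 < ν*(2-(1+ν)*u0)-u0*(1+ν)^2 := pos_of_mul_pos_right h (by positivity)
        have : 0 ≤ 4*(1+ν)^2-ν^2-(1+ν)^2 := by ring_nf; positivity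
        positivity)
      hx hxy hyz (le_of_le_of_eq Rx (by ring)) (le_of_le_of_eq Rz (by ring))
    exact le_of_le_of_eq this (by ring)
  · have hν : 0 < ν := by
      rcases eq_or_lt_of_le hν with rfl | h
      · linarith
      · exact h
    obtain ⟨τ, hτ, rfl⟩ : ∃ τ, 0 < τ ∧ u0 = -(ν*τ) :=
      ⟨-u0/ν, by apply div_pos <;> linarith, by field_simp⟩
    have hx' : 0 < x - τ := by
      have : 0 < ν * (x - τ) := by linarith
      exact pos_of_mul_pos_right this hν.le
    have := aux_quart (4*s*τ) (4*s*(ν*τ-1)) (ν^2*(4*τ-τ^2)+4*s*ν)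
      (ν^2*(4-2*(1+ν)*τ)) (ν^2*(1+ν)^2) (x-τ) (y-τ) (z-τ) (by positivity) (by positivity)
      (by
        intro h
        have h' : 0 < 4-2*(1+ν)*τ := pos_of_mul_pos_right h (by positivity)
        have : 0 ≤ 4*τ-τ^2 := by
          have : τ ≤ 2 := by nlinarith [mul_pos hν hτ]
          nlinarith
        positivity)
      hx' (by linarith) (by linarith) (le_of_le_of_eq Rx (by ring)) (le_of_le_of_eq Rz (by ring))
    exact le_of_le_of_eq this (by ring)

/-- the squared modulus in terms of the cosine -/
noncomputable def auxD (b c x : ℝ) : ℝ := 4*c*x^2 + 2*b*(1+c)*x + (1-c)^2 + b^2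

noncomputable def auxR (b c : ℝ) : ℝ :=
  if 0 < c ∧ |b| * (1 + c) / (4 * c) < 1 then
    |1 - c| * Real.sqrt (1 - b ^ 2 / (4 * c))
  else |(|1 + c| - |b|)|

lemma aux_b2 (b c : ℝ) (hc : 0 < c) (hB : |b| * (1 + c) < 4 * c) : b^2 < 4*c := by
  have h := mul_self_lt_mul_self (by positivity) hB
  have h2 : b^2 = |b| * |b| := by rw [abs_mul_abs_self]; ring
  have : b^2*(1+c)^2 < 4*c*(1+c)^2 := by
    rw [h2]; nlinarith [mul_nonneg hc.le (sq_nonneg (1-c))]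
  exact lt_of_mul_lt_mul_right this (by positivity)

lemma aux_RB (b c : ℝ) (hc : 0 < c) (hB : |b| * (1 + c) < 4 * c) :
    4*c*(auxR b c)^2 = (1-c)^2*(4*c-b^2) := by
  have hb := aux_b2 b c hc hB
  rw [auxR, if_pos ⟨hc, by rw [div_lt_one (by positivity)]; exact hB⟩, mul_pow, sq_abs,
    Real.sq_sqrt]
  · field_simp
  · rw [sub_nonneg, div_le_one (by positivity)]; exact hb.le

lemma aux_RA (b c : ℝ) (h1 : 0 < 1+c+b) (h2 : 0 < 1+c-b) (hB : 4 * c ≤ |b| * (1 + c)) :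
    auxR b c = 1 + c - |b| := by
  have : |b| < 1 + c := by rw [abs_lt]; constructor <;> linarith
  rw [auxR, if_neg, abs_of_pos (show 0 < 1+c by linarith), abs_of_pos (by linarith)]
  rintro ⟨hc, h⟩
  rw [div_lt_one (by positivity)] at h
  linarith

lemma aux_Rpos (b c : ℝ) (hc : c < 1) (h1 : 0 < 1+c+b) (h2 : 0 < 1+c-b) : 0 < auxR b c := by
  rcases lt_or_ge (|b| * (1 + c)) (4 * c) with hB | hB
  · have hc0 : 0 < c := by
      have := mul_nonneg (abs_nonneg b) (show 0 ≤ 1+c by linarith)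
      linarith
    have hb := aux_b2 b c hc0 hB
    rw [auxR, if_pos ⟨hc0, by rw [div_lt_one (by positivity)]; exact hB⟩]
    apply mul_pos
    · rw [abs_pos]; linarith
    · apply Real.sqrt_pos.2
      rw [sub_pos, div_lt_one (by positivity)]; exact hb
  · rw [aux_RA b c h1 h2 hB]
    have : |b| < 1 + c := by rw [abs_lt]; constructor <;> linarith
    linarith

lemma aux_Rle (b c x : ℝ) (h1 : 0 < 1+c+b) (h2 : 0 < 1+c-b) (hx : |x| ≤ 1) :
    (auxR b c)^2 ≤ auxD b c x := by
  rcases lt_or_ge (|b| * (1 + c)) (4 * c) with hB | hB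
  · have hc0 : 0 < c := by
      have := mul_nonneg (abs_nonneg b) (show 0 ≤ 1+c by linarith)
      linarith
    have := aux_RB b c hc0 hB
    have e : 4*c*auxD b c x = (4*c*x+b*(1+c))^2 + (1-c)^2*(4*c-b^2) := by rw [auxD]; ring
    have : 4*c*(auxR b c)^2 ≤ 4*c*auxD b c x := by
      rw [this, e]; nlinarith [sq_nonneg (4*c*x+b*(1+c))]
    exact le_of_mul_le_mul_left this (by positivity)
  · rw [aux_RA b c h1 h2 hB, auxD]
    obtain ⟨hx1, hx2⟩ := abs_le.1 hx
    rcases abs_cases b with ⟨hb, hb'⟩ | ⟨hb, hb'⟩ <;> rw [hb] at hB ⊢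
    · have : 4*c*x^2 + 2*b*(1+c)*x + (1-c)^2 + b^2 - (1+c-b)^2
        = (1+x)*(2*(b*(1+c)-4*c) + 4*c*(1+x)) := by ring
      have h3 : 0 ≤ 2*(b*(1+c)-4*c) + 4*c*(1+x) := by
        rcases le_or_gt 0 c with h | h
        · have := mul_nonneg h (show 0 ≤ 1+x by linarith); linarith
        · nlinarith [mul_nonneg hb' (show 0 ≤ 1+c by linarith), mul_nonneg (neg_pos.2 h).le (show 0 ≤ 1-x by linarith)]
      nlinarith [mul_nonneg (show 0 ≤ 1+x by linarith) h3]
    · have : 4*c*x^2 + 2*b*(1+c)*x + (1-c)^2 + b^2 - (1+c+b)^2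
        = (1-x)*(2*(-b*(1+c)-4*c) + 4*c*(1-x)) := by ring
      have h3 : 0 ≤ 2*(-b*(1+c)-4*c) + 4*c*(1-x) := by
        rcases le_or_gt 0 c with h | h
        · have := mul_nonneg h (show 0 ≤ 1-x by linarith); linarith
        · nlinarith [mul_nonneg (neg_pos.2 hb').le (show 0 ≤ 1+c by linarith), mul_nonneg (neg_pos.2 h).le (show 0 ≤ 1+x by linarith)]
      nlinarith [mul_nonneg (show 0 ≤ 1-x by linarith) h3]

lemma aux_Rex (b c : ℝ) (h1 : 0 < 1+c+b) (h2 : 0 < 1+c-b) :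
    ∃ x, |x| ≤ 1 ∧ auxD b c x = (auxR b c)^2 := by
  rcases lt_or_ge (|b| * (1 + c)) (4 * c) with hB | hB
  · have hc0 : 0 < c := by
      have := mul_nonneg (abs_nonneg b) (show 0 ≤ 1+c by linarith)
      linarith
    have := aux_RB b c hc0 hB
    refine ⟨-(b*(1+c))/(4*c), ?_, ?_⟩
    · rw [abs_div, abs_neg, abs_mul, abs_of_pos (show 0 < 4*c by positivity),
        abs_of_pos (show 0 < 1+c by linarith), div_le_one (by positivity)]
      exact hB.le
    · have e : 4*c*auxD b c (-(b*(1+c))/(4*c)) = (1-c)^2*(4*c-b^2) := by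
        rw [auxD]; field_simp; ring
      rw [← this] at e
      exact mul_left_cancel₀ (by positivity) e
  · rw [aux_RA b c h1 h2 hB]
    rcases abs_cases b with ⟨hb, hb'⟩ | ⟨hb, hb'⟩ <;> rw [hb]
    · exact ⟨-1, by norm_num, by rw [auxD]; ring⟩
    · exact ⟨1, by norm_num, by rw [auxD]; ring⟩

lemma aux_quasi (β ν s x y z : ℝ) (hν : 0 ≤ ν) (hs : 0 ≤ s) (hx : 0 < x)
    (hxy : x ≤ y) (hyz : y ≤ z) (hcx : β - x*ν < 1) (hz : 0 < 1 + (β - z*ν) - (z*(1+ν)-(1+β)))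
    (gx : s * x ≤ auxR (x*(1+ν)-(1+β)) (β-x*ν)^2)
    (gz : s * z ≤ auxR (z*(1+ν)-(1+β)) (β-z*ν)^2) :
    s * y ≤ auxR (y*(1+ν)-(1+β)) (β-y*ν)^2 := by
  have st1 : ∀ t, x ≤ t → 0 < 1 + (β-t*ν) + (t*(1+ν)-(1+β)) := fun t h => by
    ring_nf; linarith
  have mon : ∀ t, t ≤ z → 1 + (β - z*ν) - (z*(1+ν)-(1+β)) ≤ 1 + (β - t*ν) - (t*(1+ν)-(1+β)) :=
    fun t h => by nlinarith
  have st2 : ∀ t, t ≤ z → 0 < 1 + (β - t*ν) - (t*(1+ν)-(1+β)) := fun t h =>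
    lt_of_lt_of_le hz (mon t h)
  have hsx : s ≤ x := by
    have := aux_Rle _ _ 1 (st1 x le_rfl) (st2 x (hxy.trans hyz)) (by norm_num)
    have e : auxD (x*(1+ν)-(1+β)) (β-x*ν) 1 = x * x := by rw [auxD]; ring
    rw [e] at this
    exact le_of_mul_le_mul_right (gx.trans this) hx
  have gA : ∀ t, x ≤ t → s * t ≤ (1 + (β-t*ν) + (t*(1+ν)-(1+β)))^2 := fun t h => by
    have : (1 + (β-t*ν) + (t*(1+ν)-(1+β))) = t := by ring
    rw [this]; nlinarith
  have gC : ∀ t, t ≤ z → s * t ≤ (1 + (β-t*ν) - (t*(1+ν)-(1+β)))^2 := fun t h => by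
    have := aux_Rle _ _ (-1) (st1 z (hxy.trans hyz)) (st2 z le_rfl) (by norm_num)
    have e : auxD (z*(1+ν)-(1+β)) (β-z*ν) (-1) = (1 + (β-z*ν) - (z*(1+ν)-(1+β)))^2 := by
      rw [auxD]; ring
    rw [e] at this
    have h3 := pow_le_pow_left₀ hz.le (mon t h) 2
    have h4 := mul_le_mul_of_nonneg_left h hs
    linarith
  -- boundary points
  have bd : ∀ t, x ≤ t → t ≤ z → |t*(1+ν)-(1+β)| * (1+(β-t*ν)) = 4*(β-t*ν) →
      0 ≤ ((1-β) + ν*t)^2*(4*t-(t+((1-β)+ν*t))^2) - 4*s*t*(1-((1-β)+ν*t)) := by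
    intro t h1 h2 h
    have p1 := st1 t h1
    have p2 := st2 t h2
    have hc : 0 ≤ β - t*ν := by
      have := mul_nonneg (abs_nonneg (t*(1+ν)-(1+β))) (show 0 ≤ 1+(β-t*ν) by linarith)
      linarith
    rcases abs_cases (t*(1+ν)-(1+β)) with ⟨hb, hb'⟩ | ⟨hb, hb'⟩ <;> rw [hb] at h
    · have e : ((1-β) + ν*t)^2*(4*t-(t+((1-β)+ν*t))^2) - 4*s*t*(1-((1-β)+ν*t))
        = 4*(β-t*ν)*((1 + (β-t*ν) - (t*(1+ν)-(1+β)))^2 - s*t)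
          - ((t*(1+ν)-(1+β)) * (1+(β-t*ν)) - 4*(β-t*ν))^2 := by ring
      rw [e, h, sub_self]
      have := mul_nonneg hc (sub_nonneg.2 (gC t h2))
      linarith
    · have e : ((1-β) + ν*t)^2*(4*t-(t+((1-β)+ν*t))^2) - 4*s*t*(1-((1-β)+ν*t))
        = 4*(β-t*ν)*((1 + (β-t*ν) + (t*(1+ν)-(1+β)))^2 - s*t)
          - (-(t*(1+ν)-(1+β)) * (1+(β-t*ν)) - 4*(β-t*ν))^2 := by ring
      rw [e, h, sub_self]
      have := mul_nonneg hc (sub_nonneg.2 (gA t h1))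
      linarith
  have inB : ∀ t, x ≤ t → t ≤ z → |t*(1+ν)-(1+β)| * (1+(β-t*ν)) < 4*(β-t*ν) →
      0 < β - t*ν ∧
      ((1-β) + ν*t)^2*(4*t-(t+((1-β)+ν*t))^2) - 4*s*t*(1-((1-β)+ν*t))
        = 4*(β-t*ν)*(auxR (t*(1+ν)-(1+β)) (β-t*ν)^2 - s*t) := by
    intro t h1 h2 h
    have p1 := st1 t h1
    have p2 := st2 t h2
    have hc : 0 < β - t*ν := by
      have := mul_nonneg (abs_nonneg (t*(1+ν)-(1+β))) (show 0 ≤ 1+(β-t*ν) by linarith)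
      linarith
    refine ⟨hc, ?_⟩
    have := aux_RB _ _ hc h
    linear_combination -this
  have cont : Continuous (fun t : ℝ => |t*(1+ν)-(1+β)| * (1+(β-t*ν)) - 4*(β-t*ν)) := by fun_prop
  rcases lt_or_ge (|y*(1+ν)-(1+β)| * (1+(β-y*ν))) (4*(β-y*ν)) with hB | hB
  · obtain ⟨hcy, ey⟩ := inB y hxy hyz hB
    obtain ⟨x', hx1, hx2, Rx⟩ : ∃ x', x ≤ x' ∧ x' ≤ y ∧
        0 ≤ ((1-β) + ν*x')^2*(4*x'-(x'+((1-β)+ν*x'))^2) - 4*s*x'*(1-((1-β)+ν*x')) := by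
      rcases lt_or_ge (|x*(1+ν)-(1+β)| * (1+(β-x*ν))) (4*(β-x*ν)) with h | h
      · obtain ⟨hcx, ex⟩ := inB x le_rfl (hxy.trans hyz) h
        refine ⟨x, le_rfl, hxy, ?_⟩
        rw [ex]
        have := mul_nonneg hcx.le (sub_nonneg.2 gx)
        linarith
      · obtain ⟨t, ⟨ht1, ht2⟩, ht⟩ := intermediate_value_Icc' hxy cont.continuousOn
          (show (0:ℝ) ∈ Set.Icc _ _ from ⟨by linarith, by linarith⟩)
        exact ⟨t, ht1, ht2, bd t ht1 (ht2.trans hyz) (sub_eq_zero.1 ht)⟩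
    obtain ⟨z', hz1, hz2, Rz⟩ : ∃ z', y ≤ z' ∧ z' ≤ z ∧
        0 ≤ ((1-β) + ν*z')^2*(4*z'-(z'+((1-β)+ν*z'))^2) - 4*s*z'*(1-((1-β)+ν*z')) := by
      rcases lt_or_ge (|z*(1+ν)-(1+β)| * (1+(β-z*ν))) (4*(β-z*ν)) with h | h
      · obtain ⟨hcz, ez⟩ := inB z (hxy.trans hyz) le_rfl h
        refine ⟨z, hyz, le_rfl, ?_⟩
        rw [ez]
        have := mul_nonneg hcz.le (sub_nonneg.2 gz)
        linarith
      · obtain ⟨t, ⟨ht1, ht2⟩, ht⟩ := intermediate_value_Icc hyz cont.continuousOn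
          (show (0:ℝ) ∈ Set.Icc _ _ from ⟨by linarith, by linarith⟩)
        exact ⟨t, ht1, ht2, bd t (hxy.trans ht1) ht2 (sub_eq_zero.1 ht)⟩
    have := aux_poly s ν (1-β) x' y z' hs hν (by linarith) hx2 hz1
      (by nlinarith) Rx Rz
    rw [ey] at this
    have := nonneg_of_mul_nonneg_right this (show 0 < 4*(β-y*ν) by linarith)
    linarith
  · rw [aux_RA _ _ (st1 y hxy) (st2 y hyz) hB]
    rcases abs_cases (y*(1+ν)-(1+β)) with ⟨hb, hb'⟩ | ⟨hb, hb'⟩ <;> rw [hb]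
    · exact gC y hyz
    · have := gA y hxy
      rwa [sub_neg_eq_add]

lemma aux_stab (b c : ℝ) (h : ∀ z : ℂ, z ^ 2 + (b : ℂ) * z + (c : ℂ) = 0 → ‖z‖ < 1) :
    c < 1 ∧ 0 < 1 + c - b := by
  constructor
  · obtain ⟨w, hw⟩ := IsAlgClosed.exists_eq_mul_self ((b:ℂ)^2 - 4*c)
    have h1 := h ((-b+w)/2) (by linear_combination (-1/4) * hw)
    have h2 := h ((-b-w)/2) (by linear_combination (-1/4) * hw)
    have e : (c:ℂ) = ((-b+w)/2) * ((-b-w)/2) := by linear_combination (-1/4) * hw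
    have e' : |c| < 1 := by
      have : ‖(c:ℂ)‖ = ‖((-b+w)/2)‖ * ‖((-b-w)/2)‖ := by rw [e, norm_mul]
      rw [Complex.norm_real, Real.norm_eq_abs] at this
      rw [this]
      exact mul_lt_one_of_nonneg_of_lt_one_left (norm_nonneg _) h1 h2.le
    exact (abs_lt.1 e').2
  · by_contra! hn
    have hd : (b-2)^2 ≤ b^2 - 4*c := by nlinarith
    have hs := Real.sq_sqrt ((sq_nonneg (b-2)).trans hd)
    have hs2 := Real.abs_le_sqrt hd
    have h1 := h (((-b - Real.sqrt (b^2-4*c))/2 : ℝ) : ℂ) (by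
      norm_cast
      linear_combination (1/4) * hs)
    rw [Complex.norm_real, Real.norm_eq_abs, abs_lt] at h1
    have := neg_abs_le (b-2)
    linarith [h1.1]

lemma aux_norm (b c ω : ℝ) :
    ‖Complex.exp (2 * ω * Complex.I) + (b : ℂ) * Complex.exp (ω * Complex.I) + (c : ℂ)‖ ^ 2
      = auxD b c (Real.cos ω) := by
  have e : Complex.exp (2 * ω * Complex.I) = Complex.exp (ω * Complex.I) ^ 2 := by
    rw [← Complex.exp_nat_mul]; congr 1; push_cast; ring
  have e2 : Complex.exp (ω * Complex.I) = ((Real.cos ω : ℝ) : ℂ) + ((Real.sin ω : ℝ) : ℂ) * Complex.I := by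
    rw [Complex.exp_mul_I]; push_cast; ring
  rw [e, e2, Complex.sq_norm, Complex.normSq_apply, auxD]
  simp [pow_two]
  have := Real.sin_sq_add_cos_sq ω
  have hs : Real.sin ω ^ 2 = 1 - Real.cos ω ^ 2 := by linarith
  have hs4 : Real.sin ω ^ 4 = (1 - Real.cos ω ^ 2)^2 := by rw [← hs]; ring
  ring_nf
  simp only [← Complex.ofReal_cos, ← Complex.ofReal_sin, Complex.ofReal_re, Complex.ofReal_im]
  rw [hs4, hs]
  ring

/-- the squared `H∞` norm of the GMM system for a strongly convex quadratic
whose Hessian has eigenvalue set `S` equals `(α²/2)·max(μ/r_μ², L/r_L²)`. -/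
theorem gmm_hinf_squared (α β ν μ L : ℝ) (hα : 0 < α) (hβ : 0 ≤ β) (hν : 0 ≤ ν)
    (hμ : 0 < μ) (hμL : μ ≤ L) (S : Finset ℝ)
    (hS : ∀ lam ∈ S, lam ∈ Set.Icc μ L) (hμS : μ ∈ S) (hLS : L ∈ S)
    (hstab : ∀ lam ∈ S, ∀ z : ℂ,
      z ^ 2 + (bCoef α β ν lam : ℂ) * z + (cCoef α β ν lam : ℂ) = 0 → ‖z‖ < 1) :
    0 < rCoef α β ν μ ∧ 0 < rCoef α β ν L ∧
      (⨆ ω : ℝ, S.sup' ⟨μ, hμS⟩ (fun lam => hFun α β ν ω lam)) =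
        α ^ 2 / 2 * max (μ / rCoef α β ν μ ^ 2) (L / rCoef α β ν L ^ 2) := by
  have hr : ∀ lam, rCoef α β ν lam = auxR (bCoef α β ν lam) (cCoef α β ν lam) := fun _ => rfl
  have hp : ∀ lam ∈ S, 0 < lam := fun lam h => lt_of_lt_of_le hμ (hS lam h).1
  have st : ∀ lam ∈ S, cCoef α β ν lam < 1 ∧ 0 < 1 + cCoef α β ν lam - bCoef α β ν lam :=
    fun lam h => aux_stab _ _ (hstab lam h)
  have st1 : ∀ lam ∈ S, 0 < 1 + cCoef α β ν lam + bCoef α β ν lam := fun lam h => by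
    have : 1 + cCoef α β ν lam + bCoef α β ν lam = α * lam := by rw [cCoef, bCoef]; ring
    rw [this]; exact mul_pos hα (hp lam h)
  have rpos : ∀ lam ∈ S, 0 < rCoef α β ν lam := fun lam h => by
    rw [hr]; exact aux_Rpos _ _ (st lam h).1 (st1 lam h) (st lam h).2
  have hh : ∀ ω lam, hFun α β ν ω lam =
      α^2/2 * (lam / auxD (bCoef α β ν lam) (cCoef α β ν lam) (Real.cos ω)) := fun ω lam => by
    rw [hFun, aux_norm]
    rw [div_mul_div_comm]
  have rμ := rpos μ hμS
  have rL := rpos L hLS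
  have hL := hp L hLS
  have key : ∀ lam ∈ S, lam / rCoef α β ν lam ^ 2 ≤
      max (μ / rCoef α β ν μ ^ 2) (L / rCoef α β ν L ^ 2) := by
    intro lam h
    have r0 := rpos lam h
    set M := max (μ / rCoef α β ν μ ^ 2) (L / rCoef α β ν L ^ 2) with hM
    have M1 : μ / rCoef α β ν μ ^ 2 ≤ M := le_max_left _ _
    have M2 : L / rCoef α β ν L ^ 2 ≤ M := le_max_right _ _
    have Mpos : 0 < M := lt_of_lt_of_le (by positivity) M1
    have q := aux_quasi β ν (1/(α*M)) (α*μ) (α*lam) (α*L) hν (by positivity) (by positivity)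
      (mul_le_mul_of_nonneg_left (hS lam h).1 hα.le) (mul_le_mul_of_nonneg_left (hS lam h).2 hα.le)
      (st μ hμS).1 (st L hLS).2
      (by
        change _ ≤ rCoef α β ν μ ^ 2
        rw [div_le_iff₀ (by positivity)] at M1
        have : 1/(α*M)*(α*μ) = μ / M := by field_simp
        rw [this, div_le_iff₀ Mpos]; linarith)
      (by
        change _ ≤ rCoef α β ν L ^ 2
        rw [div_le_iff₀ (by positivity)] at M2
        have : 1/(α*M)*(α*L) = L / M := by field_simp
        rw [this, div_le_iff₀ Mpos]; linarith)
    change _ ≤ rCoef α β ν lam ^ 2 at q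
    have : 1/(α*M)*(α*lam) = lam / M := by field_simp
    rw [this, div_le_iff₀ Mpos] at q
    rw [div_le_iff₀ (by positivity)]
    linarith
  have ub : ∀ ω : ℝ, S.sup' ⟨μ, hμS⟩ (fun lam => hFun α β ν ω lam) ≤
      α ^ 2 / 2 * max (μ / rCoef α β ν μ ^ 2) (L / rCoef α β ν L ^ 2) := by
    intro ω
    apply Finset.sup'_le
    intro lam h
    rw [hh]
    apply mul_le_mul_of_nonneg_left _ (by positivity)
    refine le_trans ?_ (key lam h)
    have r0 := rpos lam h
    apply div_le_div_of_nonneg_left (hp lam h).le (by positivity)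
    exact aux_Rle _ _ _ (st1 lam h) (st lam h).2 (Real.abs_cos_le_one ω)
  have lb : ∀ lam ∈ S, α^2/2 * (lam / rCoef α β ν lam ^ 2) ≤
      ⨆ ω : ℝ, S.sup' ⟨μ, hμS⟩ (fun lam => hFun α β ν ω lam) := by
    intro lam h
    obtain ⟨x, hx, e⟩ := aux_Rex _ _ (st1 lam h) (st lam h).2
    obtain ⟨hx1, hx2⟩ := abs_le.1 hx
    refine le_trans ?_ (le_ciSup ⟨_, Set.forall_mem_range.2 ub⟩ (Real.arccos x))
    refine le_trans (le_of_eq ?_) (Finset.le_sup' (fun lam => hFun α β ν (Real.arccos x) lam) h)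
    change _ = hFun α β ν (Real.arccos x) lam
    rw [hh, Real.cos_arccos hx1 hx2, e, hr]
  refine ⟨rμ, rL, le_antisymm (ciSup_le ub) ?_⟩
  rcases max_choice (μ / rCoef α β ν μ ^ 2) (L / rCoef α β ν L ^ 2) with h | h <;> rw [h]
  · exact lb μ hμS
  · exact lb L hLS
end

section
/- Let 0 < μ < L and assume that for each λ ∈ {μ, L} both complex roots of z² + b_λ·z + c_λ have modulus strictly less than 1 (so r_μ > 0 and r_L > 0). Then (α/√2)·max(√μ/r_μ, √L/r_L) ≥ 1/√(2μ), and equality holds if and only if both of the following hold: (a) c_μ ≤ 0 or |b_μ·(1+c_μ)| ≥ 4|c_μ|, and (b) α·√(Lμ) ≤ r_L. -/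
lemma stab_aux (b c : ℝ) (h : ∀ z : ℂ, z ^ 2 + (b : ℂ) * z + (c : ℂ) = 0 → ‖z‖ < 1) :
    |b| < 1 + c ∧ c < 1 := by
  rcases le_or_gt 0 (b ^ 2 - 4 * c) with hD | hD
  · have hs := Real.sq_sqrt hD
    set s := Real.sqrt (b ^ 2 - 4 * c) with hs_def
    have key : ∀ x : ℝ, x ^ 2 + b * x + c = 0 → |x| < 1 := by
      intro x hx
      have := h (x : ℂ) (by exact_mod_cast hx)
      simpa using this
    have h1 := abs_lt.mp (key ((-b + s) / 2) (by nlinarith))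
    have h2 := abs_lt.mp (key ((-b - s) / 2) (by nlinarith))
    obtain ⟨h11, h12⟩ := h1
    obtain ⟨h21, h22⟩ := h2
    have p1 := mul_pos (sub_pos.mpr h12) (sub_pos.mpr h22)
    have p2 := mul_pos (sub_pos.mpr h11) (sub_pos.mpr h21)
    have p3 := mul_pos (sub_pos.mpr h12) (sub_pos.mpr h21)
    have p4 := mul_pos (sub_pos.mpr h11) (sub_pos.mpr h22)
    refine ⟨abs_lt.mpr ⟨by nlinarith, by nlinarith⟩, by nlinarith⟩
  · have hD' : 0 ≤ 4 * c - b ^ 2 := by linarith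
    have hs := Real.sq_sqrt hD'
    set s := Real.sqrt (4 * c - b ^ 2) with hs_def
    have h1 := h (⟨-b / 2, s / 2⟩ : ℂ) (by
      apply Complex.ext
      · simp [pow_two]; nlinarith
      · simp [pow_two]; ring)
    have h2 : Complex.normSq (⟨-b / 2, s / 2⟩ : ℂ) < 1 := by
      rw [Complex.normSq_eq_norm_sq]
      have := norm_nonneg (⟨-b / 2, s / 2⟩ : ℂ)
      nlinarith
    rw [Complex.normSq_mk] at h2
    have hc : c < 1 := by nlinarith
    have hc0 : 0 < c := by nlinarith [sq_nonneg b]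
    refine ⟨?_, hc⟩
    apply abs_lt_of_sq_lt_sq _ (by linarith)
    nlinarith [sq_nonneg (1 - c)]

lemma r_aux (α β ν l : ℝ)
    (hb : |bCoef α β ν l| < 1 + cCoef α β ν l) (hc : cCoef α β ν l < 1) :
    0 < rCoef α β ν l ∧ rCoef α β ν l ≤ 1 + cCoef α β ν l - |bCoef α β ν l| ∧
    (rCoef α β ν l = 1 + cCoef α β ν l - |bCoef α β ν l| ↔
      (cCoef α β ν l ≤ 0 ∨
        4 * |cCoef α β ν l| ≤ |bCoef α β ν l * (1 + cCoef α β ν l)|)) := by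
  unfold rCoef
  set b := bCoef α β ν l
  set c := cCoef α β ν l
  have hb0 := abs_nonneg b
  have hc1 : 0 < 1 + c := by linarith
  have hbb := sq_abs b
  rw [abs_mul, abs_of_pos hc1]
  split_ifs with hif
  · obtain ⟨hc0, hlt⟩ := hif
    rw [div_lt_one (by linarith)] at hlt
    rw [abs_of_pos hc0, abs_of_pos (sub_pos.mpr hc)]
    have hq : 0 < 1 - b ^ 2 / (4 * c) := by
      rw [sub_pos, div_lt_one (by linarith), ← hbb]
      have h1 : (|b| * (1 + c)) ^ 2 < (4 * c) ^ 2 := by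
        apply pow_lt_pow_left₀ hlt (by positivity) (by norm_num)
      have h2 : |b| ^ 2 * (4 * c) ≤ (|b| * (1 + c)) ^ 2 := by
        nlinarith [mul_nonneg (sq_nonneg |b|) (sq_nonneg (1 - c))]
      nlinarith
    have hlt2 : (1 - c) * Real.sqrt (1 - b ^ 2 / (4 * c)) < 1 + c - |b| := by
      apply lt_of_pow_lt_pow_left₀ 2 (by linarith)
      rw [mul_pow, Real.sq_sqrt hq.le]
      have : (1 + c - |b|) ^ 2 - (1 - c) ^ 2 * (1 - b ^ 2 / (4 * c))
          = (4 * c - |b| * (1 + c)) ^ 2 / (4 * c) := by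
        rw [← hbb]; field_simp; ring
      have h3 : 0 < (4 * c - |b| * (1 + c)) ^ 2 / (4 * c) := by
        have : 0 < 4 * c - |b| * (1 + c) := by linarith
        positivity
      linarith
    refine ⟨mul_pos (by linarith) (Real.sqrt_pos.mpr hq), hlt2.le, ?_⟩
    constructor
    · intro h; exact absurd h hlt2.ne
    · rintro (h | h) <;> linarith
  · rw [abs_of_pos (show 0 < 1 + c - |b| by linarith)]
    refine ⟨by linarith, le_rfl, ?_⟩
    simp only [true_iff]
    by_cases hc0 : 0 < c
    · right
      rw [abs_of_pos hc0]
      by_contra hcon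
      refine hif ⟨hc0, ?_⟩
      rw [div_lt_one (by linarith)]
      linarith
    · left; linarith

/-- the H∞ norm `(α/√2)·max(√μ/r_μ, √L/r_L)` of GMM is at least `1/√(2μ)`,
with equality iff `(c_μ ≤ 0 ∨ |b_μ(1+c_μ)| ≥ 4|c_μ|)` and `α√(Lμ) ≤ r_L`. -/
theorem gmm_hinf_lower_bound_and_optimality (α β ν μ L : ℝ)
    (hα : 0 < α) (hβ : 0 ≤ β) (hν : 0 ≤ ν) (hμ : 0 < μ) (hμL : μ < L)
    (hstab : ∀ lam ∈ ({μ, L} : Set ℝ), ∀ z : ℂ,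
      z ^ 2 + (bCoef α β ν lam : ℂ) * z + (cCoef α β ν lam : ℂ) = 0 → ‖z‖ < 1) :
    1 / Real.sqrt (2 * μ) ≤
      α / Real.sqrt 2 *
        max (Real.sqrt μ / rCoef α β ν μ) (Real.sqrt L / rCoef α β ν L) ∧
    (α / Real.sqrt 2 *
        max (Real.sqrt μ / rCoef α β ν μ) (Real.sqrt L / rCoef α β ν L) =
        1 / Real.sqrt (2 * μ) ↔
      (cCoef α β ν μ ≤ 0 ∨
        4 * |cCoef α β ν μ| ≤ |bCoef α β ν μ * (1 + cCoef α β ν μ)|) ∧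
      α * Real.sqrt (L * μ) ≤ rCoef α β ν L) := by
  obtain ⟨hbμ, hcμ⟩ := stab_aux _ _ (hstab μ (by simp))
  obtain ⟨hbL, hcL⟩ := stab_aux _ _ (hstab L (by simp))
  obtain ⟨hrμ, hrμ', hiff⟩ := r_aux α β ν μ hbμ hcμ
  obtain ⟨hrL, hrL', -⟩ := r_aux α β ν L hbL hcL
  rw [← hiff]
  have hsum : 1 + cCoef α β ν μ + bCoef α β ν μ = α * μ := by
    unfold cCoef bCoef; ring
  have hcle : cCoef α β ν L ≤ cCoef α β ν μ := by
    unfold cCoef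
    nlinarith [mul_nonneg (mul_nonneg hα.le hν) (sub_pos.mpr hμL).le]
  have hble : bCoef α β ν μ ≤ bCoef α β ν L := by
    unfold bCoef
    nlinarith [mul_nonneg (mul_nonneg hα.le hν) (sub_pos.mpr hμL).le,
      mul_pos hα (sub_pos.mpr hμL)]
  generalize rCoef α β ν μ = p at *
  generalize rCoef α β ν L = q at *
  generalize bCoef α β ν μ = b at *
  generalize cCoef α β ν μ = c at *
  have hL : 0 < L := hμ.trans hμL
  have hm : 0 < Real.sqrt μ := Real.sqrt_pos.mpr hμ
  have hl : 0 < Real.sqrt L := Real.sqrt_pos.mpr hL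
  have h2 : 0 < Real.sqrt 2 := by positivity
  have hmm : Real.sqrt μ * Real.sqrt μ = μ := Real.mul_self_sqrt hμ.le
  have hml : Real.sqrt μ < Real.sqrt L := Real.sqrt_lt_sqrt hμ.le hμL
  rw [Real.sqrt_mul (by norm_num) μ, Real.sqrt_mul hL.le μ]
  have e1 : 1 / (Real.sqrt 2 * Real.sqrt μ) = α / Real.sqrt 2 * (1 / (α * Real.sqrt μ)) := by
    field_simp
  have hk : 0 < α / Real.sqrt 2 := by positivity
  rw [e1]
  have hb1 := neg_abs_le b
  have hple : p ≤ α * μ := by linarith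
  have hge : 1 / (α * Real.sqrt μ) ≤ Real.sqrt μ / p := by
    rw [div_le_div_iff₀ (by positivity) hrμ]
    nlinarith
  have hge' : Real.sqrt μ / p ≤ 1 / (α * Real.sqrt μ) ↔ α * μ ≤ p := by
    rw [div_le_div_iff₀ hrμ (by positivity)]
    have : Real.sqrt μ * (α * Real.sqrt μ) = α * μ := by rw [← hmm]; ring_nf; simp [hm.le]
    rw [this, one_mul]
  have hqe : Real.sqrt L / q ≤ 1 / (α * Real.sqrt μ) ↔
      α * (Real.sqrt L * Real.sqrt μ) ≤ q := by
    rw [div_le_div_iff₀ hrL (by positivity), one_mul]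
    rw [show Real.sqrt L * (α * Real.sqrt μ) = α * (Real.sqrt L * Real.sqrt μ) by ring]
  refine ⟨mul_le_mul_of_nonneg_left (hge.trans (le_max_left _ _)) hk.le, ?_⟩
  rw [mul_right_inj' hk.ne']
  constructor
  · intro h
    have ha := hge'.mp (h ▸ le_max_left _ _)
    have hb := hqe.mp (h ▸ le_max_right _ _)
    exact ⟨by linarith, hb⟩
  · rintro ⟨ha, hb⟩
    apply le_antisymm
    · apply max_le _ (hqe.mpr hb)
      rw [hge']
      rcases le_or_gt b 0 with h0 | h0
      · rw [abs_of_nonpos h0] at ha; linarith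
      · exfalso
        have := le_abs_self (bCoef α β ν L)
        have h5 : α * μ < α * (Real.sqrt L * Real.sqrt μ) := by
          apply mul_lt_mul_of_pos_left _ hα
          nlinarith
        linarith
    · exact hge.trans (le_max_left _ _)
end

section
/- For every λ > 0 one has r_λ ≤ αλ. Moreover, if c_λ > 0 and |b_λ·(1+c_λ)| < 4|c_λ|, then the inequality is strict: r_λ < αλ. Consequently, the equality r_λ = αλ can hold only if c_λ ≤ 0 or |b_λ·(1+c_λ)| ≥ 4|c_λ|. -/
theorem rcoef_aux_lt (b c x : ℝ) (hx : 0 < x) (h : b + (1 + c) = x) (hc : 0 < c)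
    (hb : |b * (1 + c)| < 4 * c) :
    |1 - c| * Real.sqrt (1 - b ^ 2 / (4 * c)) < x := by
  have h1 : 0 < b * (1 + c) + 4 * c := by linarith [(abs_lt.mp hb).1]
  have key : x ^ 2 - (1 - c) ^ 2 * (1 - b ^ 2 / (4 * c))
      = (b * (1 + c) + 4 * c) ^ 2 / (4 * c) := by
    subst h
    field_simp
    ring
  have hpos : 0 < (b * (1 + c) + 4 * c) ^ 2 / (4 * c) := by positivity
  rw [← Real.sqrt_sq_eq_abs, ← Real.sqrt_mul (sq_nonneg _), Real.sqrt_lt' hx]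
  linarith

theorem rcoef_aux_strict (α β ν lam : ℝ) (hx : 0 < α * lam) (hc : 0 < cCoef α β ν lam)
    (hb : |bCoef α β ν lam * (1 + cCoef α β ν lam)| < 4 * cCoef α β ν lam) :
    rCoef α β ν lam < α * lam := by
  have h : bCoef α β ν lam + (1 + cCoef α β ν lam) = α * lam := by
    unfold bCoef cCoef; ring
  have h2 := hb
  rw [abs_mul, abs_of_pos (show 0 < 1 + cCoef α β ν lam by linarith)] at h2
  unfold rCoef
  rw [if_pos ⟨hc, (div_lt_one (by linarith)).2 h2⟩]
  exact rcoef_aux_lt _ _ _ hx h hc hb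

/-- `r_λ ≤ αλ` always; the inequality is strict when `c_λ > 0` and
`|b_λ(1+c_λ)| < 4|c_λ|`; hence equality implies `c_λ ≤ 0` or `|b_λ(1+c_λ)| ≥ 4|c_λ|`. -/
theorem rcoef_le_alpha_lambda (α β ν : ℝ) (hα : 0 < α) (hβ : 0 ≤ β) (hν : 0 ≤ ν) :
    (∀ lam : ℝ, 0 < lam → rCoef α β ν lam ≤ α * lam) ∧
    (∀ lam : ℝ, 0 < lam → 0 < cCoef α β ν lam →
      |bCoef α β ν lam * (1 + cCoef α β ν lam)| < 4 * |cCoef α β ν lam| →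
      rCoef α β ν lam < α * lam) ∧
    (∀ lam : ℝ, 0 < lam → rCoef α β ν lam = α * lam →
      cCoef α β ν lam ≤ 0 ∨
        4 * |cCoef α β ν lam| ≤ |bCoef α β ν lam * (1 + cCoef α β ν lam)|) := by
  have strict : ∀ lam : ℝ, 0 < lam → 0 < cCoef α β ν lam →
      |bCoef α β ν lam * (1 + cCoef α β ν lam)| < 4 * |cCoef α β ν lam| →
      rCoef α β ν lam < α * lam := by
    intro lam hl hc hb
    rw [abs_of_pos hc] at hb
    exact rcoef_aux_strict α β ν lam (mul_pos hα hl) hc hb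
  refine ⟨?_, strict, ?_⟩
  · intro lam hl
    have hx := mul_pos hα hl
    by_cases hcond : 0 < cCoef α β ν lam ∧
      |bCoef α β ν lam| * (1 + cCoef α β ν lam) / (4 * cCoef α β ν lam) < 1
    · obtain ⟨hc, hb⟩ := hcond
      rw [div_lt_one (by linarith)] at hb
      refine (rcoef_aux_strict α β ν lam hx hc ?_).le
      rwa [abs_mul, abs_of_pos (show 0 < 1 + cCoef α β ν lam by linarith)]
    · have h : (1 + cCoef α β ν lam) - (-bCoef α β ν lam) = α * lam := by
        unfold bCoef cCoef; ring
      unfold rCoef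
      rw [if_neg hcond]
      have h3 := abs_abs_sub_abs_le (1 + cCoef α β ν lam) (-bCoef α β ν lam)
      rwa [abs_neg, h, abs_of_pos hx] at h3
  · intro lam hl he
    by_contra! hcon
    exact absurd he (strict lam hl hcon.1 hcon.2).ne
end

section
/- Let b, c ∈ ℝ. Then min_{ω ∈ ℝ} |e^{2iω} + b·e^{iω} + c|² = (1−c)²·(1 − b²/(4c)) if c > 0 and |b|(1+c)/(4c) < 1, and equals (|1+c| − |b|)² otherwise. Moreover, the minimum is attained at ω = arccos(−b(1+c)/(4c)) if c > 0 and |b(1+c)| < 4|c|; at ω = π if (c ≤ 0 or |b(1+c)| ≥ 4|c|) and (1 − b + c)² ≤ (1 + b + c)²; and at ω = 0 otherwise. -/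
/-- `E(ω) := |e^{2iω} + b·e^{iω} + c|²`. -/
noncomputable def Efun (b c ω : ℝ) : ℝ :=
  ‖Complex.exp (2 * ω * Complex.I) +
    (b : ℂ) * Complex.exp (ω * Complex.I) + (c : ℂ)‖ ^ 2

/-- The claimed minimal value of `E`. -/
noncomputable def Emin (b c : ℝ) : ℝ :=
  if 0 < c ∧ |b| * (1 + c) / (4 * c) < 1 then (1 - c) ^ 2 * (1 - b ^ 2 / (4 * c))
  else (|1 + c| - |b|) ^ 2

/-- The claimed minimizer `ω_*` of `E`. -/
noncomputable def omegaStar (b c : ℝ) : ℝ :=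
  if 0 < c ∧ |b * (1 + c)| < 4 * |c| then Real.arccos (-(b * (1 + c)) / (4 * c))
  else if (c ≤ 0 ∨ 4 * |c| ≤ |b * (1 + c)|) ∧ (1 - b + c) ^ 2 ≤ (1 + b + c) ^ 2 then Real.pi
  else 0

theorem Efun_eq (b c w : ℝ) : Efun b c w =
    4 * c * Real.cos w ^ 2 + 2 * (b * (1 + c)) * Real.cos w + b ^ 2 + (1 - c) ^ 2 := by
  have h2 : Complex.exp (2 * w * Complex.I) = Complex.exp (w * Complex.I) ^ 2 := by
    rw [← Complex.exp_nat_mul]; congr 1; push_cast; ring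
  unfold Efun
  rw [h2, Complex.exp_mul_I, ← Complex.ofReal_cos, ← Complex.ofReal_sin, ← Complex.normSq_eq_norm_sq,
    Complex.normSq_apply]
  have hs := Real.sin_sq_add_cos_sq w
  generalize Real.sin w = y at *
  generalize Real.cos w = x at *
  simp [pow_two]
  have hy : y ^ 2 = 1 - x ^ 2 := by linarith
  have e : (x * x - y * y + b * x + c) * (x * x - y * y + b * x + c) +
      (x * y + y * x + b * y) * (x * y + y * x + b * y) =
      (y ^ 2) ^ 2 + y ^ 2 * (2 * x ^ 2 + 2 * b * x + b ^ 2 - 2 * c) + (x ^ 2 + b * x + c) ^ 2 := by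
    ring
  rw [e, hy]; ring

theorem Emin_else (b c : ℝ) : (|1 + c| - |b|) ^ 2 = (1 + c) ^ 2 + b ^ 2 - 2 * |b * (1 + c)| := by
  rw [abs_mul]
  nlinarith [sq_abs (1 + c), sq_abs b]

/-- `min_{ω ∈ ℝ} |e^{2iω} + b e^{iω} + c|²` equals `Emin b c`, and the
minimum is attained at `ω = omegaStar b c`. -/
theorem min_modulus_squared (b c : ℝ) :
    (∀ ω : ℝ, Emin b c ≤ Efun b c ω) ∧ Efun b c (omegaStar b c) = Emin b c := by
  have hcond : (0 < c ∧ |b| * (1 + c) / (4 * c) < 1) ↔ (0 < c ∧ |b * (1 + c)| < 4 * |c|) := by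
    refine and_congr_right fun hc => ?_
    rw [div_lt_one (by positivity), abs_mul, abs_of_pos hc, abs_of_pos (by linarith : 0 < 1 + c)]
  unfold Emin omegaStar
  simp only [hcond, Efun_eq]
  by_cases h : 0 < c ∧ |b * (1 + c)| < 4 * |c|
  · simp only [if_pos h]
    obtain ⟨hc, hb⟩ := h
    rw [abs_of_pos hc, abs_lt] at hb
    have key : ∀ x : ℝ, 4 * c * x ^ 2 + 2 * (b * (1 + c)) * x + b ^ 2 + (1 - c) ^ 2 =
        (1 - c) ^ 2 * (1 - b ^ 2 / (4 * c)) + 4 * c * (x - -(b * (1 + c)) / (4 * c)) ^ 2 := by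
      intro x; field_simp; ring
    constructor
    · intro w
      rw [key]
      have : 0 ≤ 4 * c * (Real.cos w - -(b * (1 + c)) / (4 * c)) ^ 2 := by positivity
      linarith
    · rw [Real.cos_arccos, key]
      · ring
      · rw [le_div_iff₀ (by positivity)]; linarith
      · rw [div_le_iff₀ (by positivity)]; linarith
  · simp only [if_neg h, Emin_else]
    have h' : c ≤ 0 ∨ 4 * |c| ≤ |b * (1 + c)| := by
      by_contra hn
      push Not at hn
      exact h hn
    constructor
    · intro w
      have h1 := Real.abs_cos_le_one w
      have h0 := abs_nonneg (Real.cos w)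
      have hm := neg_abs_le (b * (1 + c) * Real.cos w)
      rw [abs_mul] at hm
      have hsq := sq_abs (Real.cos w)
      have hB := abs_nonneg (b * (1 + c))
      generalize |b * (1 + c)| = B at *
      generalize |Real.cos w| = t at *
      have h3 : 0 ≤ (1 - t) * (2 * B - 4 * c * (1 + t)) := by
        apply mul_nonneg (by linarith)
        rcases h' with hc | hc
        · nlinarith
        · have := le_abs_self c
          nlinarith [abs_nonneg c]
      rw [← hsq]
      nlinarith
    · simp only [h', true_and]
      split_ifs with hq
      · rw [Real.cos_pi, abs_of_nonneg (by nlinarith)]; ring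
      · rw [Real.cos_zero, abs_of_nonpos (by nlinarith)]; ring
end

section
/- Let 0 < μ < L, β = ν = 0 (gradient descent; so b_λ = αλ − 1 and c_λ = 0 for all λ > 0) and 0 < α < 2/L. Then (α/√2)·max(√μ/r_μ, √L/r_L) = 1/√(2μ) if 0 < α ≤ 2/(L + √(Lμ)), and = α√L/(√2·(2 − αL)) if 2/(L + √(Lμ)) < α < 2/L. In particular, this quantity tends to +∞ as α → 2/L. -/
/-- The H∞ norm (ℓ2 gain) of gradient descent (`β = ν = 0`) with stepsize `α`. -/
noncomputable def HinfGD (μ L α : ℝ) : ℝ :=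
  α / Real.sqrt 2 * max (Real.sqrt μ / rCoef α 0 0 μ) (Real.sqrt L / rCoef α 0 0 L)

theorem rCoef_gd (α lam : ℝ) (h0 : 0 < α * lam) (h2 : α * lam < 2) :
    rCoef α 0 0 lam = min (α * lam) (2 - α * lam) := by
  have hc : cCoef α 0 0 lam = 0 := by simp [cCoef]
  have hb : bCoef α 0 0 lam = α * lam - 1 := by simp [bCoef]
  unfold rCoef
  rw [hc, hb, if_neg (by simp)]
  rw [add_zero, abs_one]
  rcases le_total (α * lam) 1 with h | h
  · rw [abs_of_nonpos (by linarith : α * lam - 1 ≤ 0), abs_of_nonneg (by linarith),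
      min_eq_left (by linarith)]
    ring
  · rw [abs_of_nonneg (by linarith : 0 ≤ α * lam - 1), abs_of_nonneg (by linarith),
      min_eq_right (by linarith)]
    ring

theorem gd_formula_aux (μ L : ℝ) (hμ : 0 < μ) (hμL : μ < L) (α : ℝ) (hα : 0 < α)
    (hα2 : α < 2 / L) :
      (α ≤ 2 / (L + Real.sqrt (L * μ)) → HinfGD μ L α = 1 / Real.sqrt (2 * μ)) ∧
      (2 / (L + Real.sqrt (L * μ)) < α →
        HinfGD μ L α = α * Real.sqrt L / (Real.sqrt 2 * (2 - α * L))) := by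
  have hL : 0 < L := hμ.trans hμL
  rw [lt_div_iff₀ hL] at hα2
  have hμ2 : α * μ < 2 := by nlinarith
  have hr2 : 0 < Real.sqrt 2 := by positivity
  unfold HinfGD
  rw [rCoef_gd α μ (by positivity) hμ2, rCoef_gd α L (by positivity) hα2,
    Real.sqrt_mul hL.le, Real.sqrt_mul (by norm_num : (0:ℝ) ≤ 2)]
  have hs : 0 < Real.sqrt μ := Real.sqrt_pos.2 hμ
  have hst : Real.sqrt μ < Real.sqrt L := Real.sqrt_lt_sqrt hμ.le hμL
  have es : Real.sqrt μ * Real.sqrt μ = μ := Real.mul_self_sqrt hμ.le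
  have et : Real.sqrt L * Real.sqrt L = L := Real.mul_self_sqrt hL.le
  generalize Real.sqrt μ = s at *
  generalize Real.sqrt L = t at *
  subst es et
  have ht : 0 < t := hs.trans hst
  have hss : s * s < t * s := by nlinarith
  have hden : 0 < t * t + t * s := by positivity
  constructor
  · intro h
    rw [le_div_iff₀ hden] at h
    have h1 : α * (s * s) ≤ α * (t * s) := mul_le_mul_of_nonneg_left hss.le hα.le
    have h3 : α * (s * t) ≤ α * (t * t) := by
      apply mul_le_mul_of_nonneg_left _ hα.le
      nlinarith
    have hm : α * (s * t) ≤ min (α * (t * t)) (2 - α * (t * t)) :=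
      le_min h3 (by nlinarith)
    rw [min_eq_left (by nlinarith : α * (s * s) ≤ 2 - α * (s * s))]
    have e1 : s / (α * (s * s)) = 1 / (α * s) := by field_simp
    have e2 : t / min (α * (t * t)) (2 - α * (t * t)) ≤ s / (α * (s * s)) := by
      calc _ ≤ t / (α * (s * t)) := by gcongr
        _ = s / (α * (s * s)) := by field_simp
    rw [max_eq_left e2]
    field_simp
  · intro h
    rw [div_lt_iff₀ hden] at h
    have h3 : α * (s * t) ≤ α * (t * t) := by
      apply mul_le_mul_of_nonneg_left _ hα.le
      nlinarith
    rw [min_eq_right (by nlinarith : 2 - α * (t * t) ≤ α * (t * t))]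
    have hd : 0 < 2 - α * (t * t) := by linarith
    have e2 : s / min (α * (s * s)) (2 - α * (s * s)) ≤ t / (2 - α * (t * t)) := by
      rw [div_le_div_iff₀ (lt_min (by positivity) (by linarith)) hd]
      rcases min_choice (α * (s * s)) (2 - α * (s * s)) with e | e <;> rw [e]
      · nlinarith
      · have : 0 ≤ (t - s) * (2 + α * (s * t)) :=
          mul_nonneg (by linarith) (by positivity)
        nlinarith
    rw [max_eq_right e2]
    field_simp

/-- the H∞ norm of gradient descent equals `1/√(2μ)` for
`0 < α ≤ 2/(L+√(Lμ))`, equals `α√L/(√2(2−αL))` for `2/(L+√(Lμ)) < α < 2/L`,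
and tends to `+∞` as `α → 2/L` from the left. -/
theorem gd_hinf_formula (μ L : ℝ) (hμ : 0 < μ) (hμL : μ < L) :
    (∀ α : ℝ, 0 < α → α < 2 / L →
      (α ≤ 2 / (L + Real.sqrt (L * μ)) → HinfGD μ L α = 1 / Real.sqrt (2 * μ)) ∧
      (2 / (L + Real.sqrt (L * μ)) < α →
        HinfGD μ L α = α * Real.sqrt L / (Real.sqrt 2 * (2 - α * L)))) ∧
    Filter.Tendsto (HinfGD μ L) (nhdsWithin (2 / L) (Set.Iio (2 / L))) Filter.atTop := by
  refine ⟨gd_formula_aux μ L hμ hμL, ?_⟩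
  have hL : 0 < L := hμ.trans hμL
  have hlt : 2 / (L + Real.sqrt (L * μ)) < 2 / L := by
    have : 0 < Real.sqrt (L * μ) := Real.sqrt_pos.2 (by positivity)
    apply div_lt_div_of_pos_left (by norm_num) hL (by linarith)
  have hpos : 0 < 2 / (L + Real.sqrt (L * μ)) := by positivity
  have hev : (fun α : ℝ => α * Real.sqrt L * (Real.sqrt 2 * (2 - α * L))⁻¹)
      =ᶠ[nhdsWithin (2 / L) (Set.Iio (2 / L))] HinfGD μ L := by
    filter_upwards [Ioo_mem_nhdsLT hlt] with α hα
    rw [(gd_formula_aux μ L hμ hμL α (hpos.trans hα.1) hα.2).2 hα.1, div_eq_mul_inv]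
  refine Filter.Tendsto.congr' hev ?_
  have hC : 0 < 2 / L * Real.sqrt L := by positivity
  refine Filter.Tendsto.pos_mul_atTop hC ?_ (Filter.Tendsto.inv_tendsto_nhdsGT_zero ?_)
  · exact ((continuous_id.mul continuous_const).tendsto (2 / L)).mono_left nhdsWithin_le_nhds
  · rw [tendsto_nhdsWithin_iff]
    constructor
    · have hc : Continuous (fun α : ℝ => Real.sqrt 2 * (2 - α * L)) := by fun_prop
      have := hc.tendsto (2 / L)
      have e : Real.sqrt 2 * (2 - 2 / L * L) = 0 := by field_simp; ring
      rw [e] at this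
      exact this.mono_left nhdsWithin_le_nhds
    · filter_upwards [self_mem_nhdsWithin] with α hα
      have h : α * L < 2 := (lt_div_iff₀ hL).1 hα
      have h2 : 0 < 2 - α * L := by linarith
      have h3 : 0 < Real.sqrt 2 * (2 - α * L) := by positivity
      exact h3
end

section
/- Let ω ∈ ℝ and, for j = 1, …, d, set D_j := e^{iω} − (1 + β − β·e^{−iω}) + αλ_j·(1 + ν − ν·e^{−iω}). If D_j ≠ 0 for every j, then the complex matrix e^{iω}·I_{2d} − A_Q is invertible and T·(e^{iω}·I_{2d} − A_Q)^{−1}·B = (1/√2)·diag(−α√(λ₁)/D₁, …, −α√(λ_d)/D_d)·Uᵀ. -/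
open Matrix

theorem gmm_block_inv {d : ℕ} (z w : ℂ) (hzw : z * w = 1) (P R G : Matrix (Fin d) (Fin d) ℂ)
    (hG : (P + w • R) * G = 1) :
    Matrix.fromBlocks P R (-1) (z • (1 : Matrix (Fin d) (Fin d) ℂ)) *
      Matrix.fromBlocks G (-(w • (G * R))) (w • G) (w • 1 - (w * w) • (G * R)) = 1 := by
  have h1 : P * G + w • (R * G) = 1 := by
    rw [← hG, add_mul, smul_mul_assoc]
  have h2 : P * (G * R) + w • (R * (G * R)) = R := by
    have := congrArg (· * R) h1
    simpa [add_mul, mul_assoc] using this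
  rw [Matrix.fromBlocks_multiply, ← Matrix.fromBlocks_one]
  congr 1
  · rw [mul_smul_comm, h1]
  · rw [mul_sub, mul_neg, mul_smul_comm, mul_smul_comm, mul_smul_comm, mul_one]
    nth_rewrite 2 [← h2]
    module
  · rw [smul_mul_assoc, one_mul, smul_smul, hzw]
    simp
  · rw [smul_mul_assoc, one_mul, smul_sub, smul_smul, smul_smul, ← mul_assoc, hzw]
    simp

/-- for the GMM system matrices of a quadratic with Hessian `Q = UΛUᵀ`,
whenever all the `D_j := e^{iω} − (1+β−βe^{−iω}) + αλ_j(1+ν−νe^{−iω})` are nonzero,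
the matrix `e^{iω}I_{2d} − A_Q` is invertible and the transfer matrix
`T(e^{iω}I − A_Q)⁻¹B` equals `(1/√2)·diag(−α√λ_j/D_j)·Uᵀ`. -/
theorem gmm_transfer_matrix (d : ℕ) (hd : 1 ≤ d) (α β ν : ℝ)
    (hα : 0 < α) (hβ : 0 ≤ β) (hν : 0 ≤ ν)
    (lam : Fin d → ℝ) (hlampos : ∀ j, 0 < lam j) (hlammono : Monotone lam)
    (U : Matrix (Fin d) (Fin d) ℝ) (hU : U * Uᵀ = 1)
    (Q : Matrix (Fin d) (Fin d) ℝ) (hQ : Q = U * Matrix.diagonal lam * Uᵀ)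
    (ω : ℝ) (D : Fin d → ℂ)
    (hD : ∀ j, D j = Complex.exp (ω * Complex.I)
      - (1 + (β : ℂ) - (β : ℂ) * Complex.exp (-(ω : ℂ) * Complex.I))
      + (α : ℂ) * (lam j : ℂ) * (1 + (ν : ℂ) - (ν : ℂ) * Complex.exp (-(ω : ℂ) * Complex.I)))
    (hDne : ∀ j, D j ≠ 0)
    (AQ : Matrix (Fin d ⊕ Fin d) (Fin d ⊕ Fin d) ℂ)
    (hAQ : AQ = Matrix.fromBlocks
      (((1 + β : ℂ)) • (1 : Matrix (Fin d) (Fin d) ℂ)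
        - ((α * (1 + ν) : ℝ) : ℂ) • (Q.map Complex.ofReal))
      ((-(β : ℂ)) • (1 : Matrix (Fin d) (Fin d) ℂ)
        + ((α * ν : ℝ) : ℂ) • (Q.map Complex.ofReal))
      (1 : Matrix (Fin d) (Fin d) ℂ) (0 : Matrix (Fin d) (Fin d) ℂ))
    (B : Matrix (Fin d ⊕ Fin d) (Fin d) ℂ)
    (hB : B = Matrix.fromRows ((-(α : ℂ)) • (1 : Matrix (Fin d) (Fin d) ℂ)) 0)
    (T : Matrix (Fin d) (Fin d ⊕ Fin d) ℂ)
    (hT : T = ((1 / Real.sqrt 2 : ℝ) : ℂ) • Matrix.fromCols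
      ((Matrix.diagonal fun j => ((Real.sqrt (lam j) : ℝ) : ℂ)) * (U.map Complex.ofReal)ᵀ) 0) :
    IsUnit (Complex.exp (ω * Complex.I) • (1 : Matrix (Fin d ⊕ Fin d) (Fin d ⊕ Fin d) ℂ) - AQ) ∧
    T * (Complex.exp (ω * Complex.I) • (1 : Matrix (Fin d ⊕ Fin d) (Fin d ⊕ Fin d) ℂ) - AQ)⁻¹ * B
      = ((1 / Real.sqrt 2 : ℝ) : ℂ) •
          ((Matrix.diagonal fun j => (-(α : ℂ) * ((Real.sqrt (lam j) : ℝ) : ℂ)) / D j)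
            * (U.map Complex.ofReal)ᵀ) := by
  have hzw : Complex.exp (ω * Complex.I) * Complex.exp (-(ω : ℂ) * Complex.I) = 1 := by
    rw [← Complex.exp_add]; simp
  generalize Complex.exp (ω * Complex.I) = z at *
  generalize Complex.exp (-(ω : ℂ) * Complex.I) = w at *
  have hV : U.map Complex.ofReal * (U.map Complex.ofReal)ᵀ = 1 := by
    have := congrArg (fun M : Matrix (Fin d) (Fin d) ℝ => M.map Complex.ofRealHom) hU
    simp [Matrix.map_mul, Matrix.transpose_map] at this
    exact this
  have hQ' : Q.map Complex.ofReal = U.map Complex.ofReal *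
      Matrix.diagonal (fun j => (lam j : ℂ)) * (U.map Complex.ofReal)ᵀ := by
    have := congrArg (fun M : Matrix (Fin d) (Fin d) ℝ => M.map Complex.ofRealHom) hQ
    simp [Matrix.map_mul, Matrix.transpose_map, Matrix.diagonal_map, Function.comp_def] at this
    exact this
  generalize U.map Complex.ofReal = V at *
  generalize Q.map Complex.ofReal = q at *
  have hV' : Vᵀ * V = 1 := mul_eq_one_comm.mp hV
  set P : Matrix (Fin d) (Fin d) ℂ :=
    z • 1 - ((1 + β : ℂ) • 1 - ((α * (1 + ν) : ℝ) : ℂ) • q) with hP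
  set R : Matrix (Fin d) (Fin d) ℂ := -((-(β : ℂ)) • 1 + ((α * ν : ℝ) : ℂ) • q) with hR
  set G : Matrix (Fin d) (Fin d) ℂ := V * Matrix.diagonal (fun j => (D j)⁻¹) * Vᵀ with hGdef
  have hM : z • (1 : Matrix (Fin d ⊕ Fin d) (Fin d ⊕ Fin d) ℂ) - AQ =
      Matrix.fromBlocks P R (-1) (z • 1) := by
    rw [hAQ, ← Matrix.fromBlocks_one, Matrix.fromBlocks_smul, sub_eq_add_neg,
      Matrix.fromBlocks_neg, Matrix.fromBlocks_add]
    congr 1 <;> simp [hP, hR, sub_eq_add_neg]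
  have hDD : Matrix.diagonal D = (z - (1 + β - β * w)) • (1 : Matrix (Fin d) (Fin d) ℂ)
      + (α * (1 + ν - ν * w)) • Matrix.diagonal (fun j => (lam j : ℂ)) := by
    ext i j
    by_cases h : i = j
    · subst h; simp [hD]; ring
    · simp [h]
  have hS : P + w • R = V * Matrix.diagonal D * Vᵀ := by
    rw [hDD, mul_add, add_mul, mul_smul_comm, mul_smul_comm, smul_mul_assoc, smul_mul_assoc,
      mul_one, hV, ← hQ', hP, hR]
    push_cast
    module
  have hDI : Matrix.diagonal D * Matrix.diagonal (fun j => (D j)⁻¹) = 1 := by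
    rw [Matrix.diagonal_mul_diagonal, ← Matrix.diagonal_one]
    congr 1; ext j; exact mul_inv_cancel₀ (hDne j)
  have hG : (P + w • R) * G = 1 := by
    rw [hS, hGdef]
    calc V * Matrix.diagonal D * Vᵀ * (V * Matrix.diagonal (fun j => (D j)⁻¹) * Vᵀ)
        = V * Matrix.diagonal D * (Vᵀ * V) * Matrix.diagonal (fun j => (D j)⁻¹) * Vᵀ := by
          simp only [mul_assoc]
      _ = V * (Matrix.diagonal D * Matrix.diagonal (fun j => (D j)⁻¹)) * Vᵀ := by
          rw [hV', mul_one]; simp only [mul_assoc]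
      _ = 1 := by rw [hDI, mul_one, hV]
  have hinv := gmm_block_inv z w hzw P R G hG
  rw [hM]
  refine ⟨IsUnit.of_mul_eq_one _ hinv, ?_⟩
  rw [Matrix.inv_eq_right_inv hinv, hT, hB, Matrix.smul_mul, Matrix.smul_mul,
    Matrix.fromCols_mul_fromBlocks, Matrix.fromCols_mul_fromRows]
  congr 1
  simp only [Matrix.zero_mul, Matrix.mul_zero, smul_zero, add_zero, mul_smul_comm, mul_one]
  have : Matrix.diagonal (fun j => ((Real.sqrt (lam j) : ℝ) : ℂ)) * Vᵀ * G =
      Matrix.diagonal (fun j => ((Real.sqrt (lam j) : ℝ) : ℂ)) * (Vᵀ * V) *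
        Matrix.diagonal (fun j => (D j)⁻¹) * Vᵀ := by
    rw [hGdef]; simp only [mul_assoc]
  rw [this, hV', mul_one, Matrix.diagonal_mul_diagonal, ← smul_mul_assoc, ← Matrix.diagonal_smul]
  congr 2
  ext j
  simp [div_eq_mul_inv, mul_assoc]
end

section
/- Fix 0 < μ < L, let κ := L/μ, and define a(κ) := √κ·(√(2κ−1) − 1)/(κ − 1) if κ ≥ 32 and a(κ) := 1 if 1 < κ < 32. Consider the robustly stable heavy-ball parameters α := a(κ)²/L, β := (1 − a(κ)/√κ)², ν := 0. Then: (i) (α/√2)·max(√μ/r_μ, √L/r_L) = 1/√(2μ); and (ii) for every d ≥ 1 and every symmetric positive definite Q ∈ ℝ^{d×d} whose smallest eigenvalue is μ and whose largest eigenvalue is L, the spectral radius of A_Q equals 1 − a(κ)/√κ. -/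
open Matrix

/-- `a(κ)` of the robustly stable heavy-ball method. -/
noncomputable def aRS (κ : ℝ) : ℝ :=
  if 32 ≤ κ then Real.sqrt κ * (Real.sqrt (2 * κ - 1) - 1) / (κ - 1) else 1

/-- The GMM iteration matrix `A_Q` (real, `2d × 2d`). -/
noncomputable def AQmat {d : ℕ} (α β ν : ℝ) (Q : Matrix (Fin d) (Fin d) ℝ) :
    Matrix (Fin d ⊕ Fin d) (Fin d ⊕ Fin d) ℝ :=
  Matrix.fromBlocks ((1 + β) • (1 : Matrix (Fin d) (Fin d) ℝ) - (α * (1 + ν)) • Q)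
    ((-β) • (1 : Matrix (Fin d) (Fin d) ℝ) + (α * ν) • Q) 1 0

lemma hb_facts (κ : ℝ) (hκ : 1 < κ) :
    0 < aRS κ ∧ 0 < aRS κ / √κ ∧ aRS κ / √κ < 1 ∧ aRS κ ^ 2 = κ * (aRS κ / √κ) ^ 2 ∧
    (aRS κ = 1 ∨ (aRS κ ^ 2 = 1 + (1 - aRS κ / √κ) ^ 2)) := by
  have hs : 0 < √κ := Real.sqrt_pos.2 (by linarith)
  have hs2 : √κ ^ 2 = κ := Real.sq_sqrt (by linarith)
  have hs1 : 1 < √κ := by nlinarith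
  have hsq : aRS κ ^ 2 = κ * (aRS κ / √κ) ^ 2 := by
    rw [div_pow, hs2]; field_simp
  by_cases h : 32 ≤ κ
  · have hw2 : √(2 * κ - 1) ^ 2 = 2 * κ - 1 := Real.sq_sqrt (by linarith)
    have hw0 : 0 ≤ √(2 * κ - 1) := Real.sqrt_nonneg _
    set w := √(2 * κ - 1) with hw
    have hw1 : 1 < w := by nlinarith
    have hk : κ = (w ^ 2 + 1) / 2 := by linarith
    have ha : aRS κ = √κ * (w - 1) / (κ - 1) := by unfold aRS; rw [if_pos h]
    have hk1 : 0 < κ - 1 := by linarith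
    have hq : aRS κ / √κ = 2 / (w + 1) := by
      rw [ha]
      have : w + 1 ≠ 0 := by positivity
      field_simp
      nlinarith
    refine ⟨?_, ?_, ?_, hsq, Or.inr ?_⟩
    · rw [ha]; have : 0 < w - 1 := by linarith
      positivity
    · rw [hq]; positivity
    · rw [hq, div_lt_one (by positivity)]; linarith
    · rw [hsq, hq, hk]
      have : w + 1 ≠ 0 := by positivity
      field_simp
      ring
  · have ha : aRS κ = 1 := by unfold aRS; rw [if_neg h]
    refine ⟨by rw [ha]; norm_num, by rw [ha]; positivity, ?_, hsq, Or.inl ha⟩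
    rw [ha, div_lt_one hs]; exact hs1

lemma hb_root (b c : ℝ) (h : b ^ 2 ≤ 4 * c) (z : ℂ) (hz : z ^ 2 + b * z + c = 0) :
    ‖z‖ ^ 2 = c := by
  have h1 := congrArg Complex.re hz
  have h2 := congrArg Complex.im hz
  simp [pow_two] at h1 h2
  rw [← Complex.normSq_eq_norm_sq, Complex.normSq_apply]
  have h3 : z.im * (2 * z.re + b) = 0 := by linarith
  have h4 : 2 * z.re + b = 0 := by
    rcases mul_eq_zero.1 h3 with h5 | h5
    · rw [h5] at h1
      have : (2 * z.re + b) ^ 2 ≤ 0 := by nlinarith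
      exact pow_eq_zero_iff (two_ne_zero) |>.1 (le_antisymm this (sq_nonneg _))
    · exact h5
  have h6 : b = -2 * z.re := by linarith
  rw [h6] at h1
  linarith

lemma hb_rmu (α q μ : ℝ) (h0 : 0 < q) (h1 : q < 1) (h : α * μ = q ^ 2) :
    rCoef α ((1 - q) ^ 2) 0 μ = q ^ 2 := by
  have hb : bCoef α ((1 - q) ^ 2) 0 μ = -(2 * (1 - q)) := by
    unfold bCoef; rw [h]; ring
  have hc : cCoef α ((1 - q) ^ 2) 0 μ = (1 - q) ^ 2 := by unfold cCoef; ring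
  unfold rCoef
  rw [hb, hc, abs_neg, abs_of_pos (show 0 < 2 * (1 - q) by linarith), if_neg]
  · rw [abs_of_pos (show 0 < 1 + (1 - q) ^ 2 by positivity)]
    rw [show 1 + (1 - q) ^ 2 - 2 * (1 - q) = q ^ 2 by ring, abs_of_pos (by positivity)]
  · rintro ⟨h2, h3⟩
    rw [div_lt_one (by linarith)] at h3
    nlinarith [mul_pos (sub_pos.2 h1) (pow_pos h0 2)]

lemma hb_rL (α q a L : ℝ) (h0 : 0 < q) (h1 : q < 1) (ha0 : 0 < a) (h : α * L = a ^ 2)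
    (ha : a = 1 ∨ a ^ 2 = 1 + (1 - q) ^ 2) :
    a * q ≤ rCoef α ((1 - q) ^ 2) 0 L := by
  have hb : bCoef α ((1 - q) ^ 2) 0 L = a ^ 2 - 1 - (1 - q) ^ 2 := by
    unfold bCoef; rw [h]; ring
  have hc : cCoef α ((1 - q) ^ 2) 0 L = (1 - q) ^ 2 := by unfold cCoef; ring
  have hq : 0 < 1 - q := by linarith
  have hcpos : 0 < (1 - q) ^ 2 := by positivity
  have hc1 : (1 - q) ^ 2 < 1 := by nlinarith
  unfold rCoef
  rw [hb, hc]
  rcases ha with ha | ha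
  · subst ha
    rw [show (1:ℝ) ^ 2 - 1 - (1 - q) ^ 2 = -(1 - q) ^ 2 by ring, abs_neg, abs_of_pos hcpos,
      if_pos ⟨hcpos, by rw [div_lt_one (by positivity)]; nlinarith⟩, abs_of_pos (by linarith)]
    rw [show 1 - (-(1 - q) ^ 2) ^ 2 / (4 * (1 - q) ^ 2) = 1 - (1 - q) ^ 2 / 4 by field_simp]
    rw [show 1 - (1 - q) ^ 2 = q * (2 - q) by ring]
    have : 1 / (2 - q) ≤ √(1 - (1 - q) ^ 2 / 4) := by
      apply Real.le_sqrt_of_sq_le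
      have h2 : 0 < 2 - q := by linarith
      rw [div_pow, div_le_iff₀ (by positivity)]
      have : 0 ≤ (1 - q) * (8 + 4 * q - 5 * q ^ 2 + q ^ 3) := by
        apply mul_nonneg hq.le
        nlinarith [pow_pos h0 3]
      nlinarith
    have h2 : 0 < 2 - q := by linarith
    calc 1 * q = q * (2 - q) * (1 / (2 - q)) := by field_simp
      _ ≤ _ := by gcongr
  · rw [show a ^ 2 - 1 - (1 - q) ^ 2 = 0 by linarith]
    rw [if_pos ⟨hcpos, by simp⟩, abs_of_pos (by linarith)]
    simp
    have : a ≤ 2 - q := by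
      apply le_of_sq_le_sq _ (by linarith)
      nlinarith
    nlinarith

lemma hb_eig {d : ℕ} (α β : ℝ) (hα : α ≠ 0) (hβ : β ≠ 0) (Q : Matrix (Fin d) (Fin d) ℝ)
    (hQ : Q.PosDef) (z : ℂ)
    (hz : z ∈ spectrum ℂ ((AQmat α β 0 Q).map (algebraMap ℝ ℂ))) :
    ∃ t ∈ spectrum ℝ Q, z ^ 2 + ((α * t - (1 + β) : ℝ) : ℂ) * z + (β : ℂ) = 0 := by
  rw [← Matrix.spectrum_toLin', ← Module.End.hasEigenvalue_iff_mem_spectrum] at hz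
  obtain ⟨x, hx⟩ := hz.exists_hasEigenvector
  have hx0 := hx.2
  have hx1 := hx.apply_eq_smul
  rw [Matrix.toLin'_apply] at hx1
  have e1 : ∀ i, (1 + β : ℂ) * x (Sum.inl i) - α * (Q.map (algebraMap ℝ ℂ) *ᵥ (x ∘ Sum.inl)) i
      - β * x (Sum.inr i) = z * x (Sum.inl i) := by
    intro i
    have := congrFun hx1 (Sum.inl i)
    simp [AQmat, Matrix.mulVec, dotProduct, Matrix.one_apply, sub_mul, Finset.sum_sub_distrib,
      ite_mul, apply_ite] at this
    simp [Matrix.mulVec, dotProduct, Finset.mul_sum]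
    rw [← this]
    simp [mul_assoc, sub_eq_add_neg]
  have e2 : ∀ i, x (Sum.inl i) = z * x (Sum.inr i) := by
    intro i
    have := congrFun hx1 (Sum.inr i)
    simpa [AQmat, Matrix.mulVec, dotProduct, Matrix.one_apply, apply_ite] using this
  have hβ' : (β : ℂ) ≠ 0 := by exact_mod_cast hβ
  have hα' : (α : ℂ) ≠ 0 := by exact_mod_cast hα
  have hv : (x ∘ Sum.inr) ≠ 0 := by
    intro h
    apply hx0
    have h' : ∀ i, x (Sum.inr i) = 0 := fun i => congrFun h i
    ext i
    rcases i with i | i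
    · rw [e2, h']; simp
    · exact h' i
  have hul : x ∘ Sum.inl = z • (x ∘ Sum.inr) := by ext i; simp [e2]
  rw [hul, Matrix.mulVec_smul] at e1
  set v := x ∘ Sum.inr with hvd
  have e3 : ∀ i, (1 + β : ℂ) * (z * v i) - α * (z * (Q.map (algebraMap ℝ ℂ) *ᵥ v) i)
      - β * v i = z * (z * v i) := by
    intro i; have := e1 i; rw [e2] at this; exact this
  have hz0 : z ≠ 0 := by
    rintro rfl
    apply hv
    ext i
    have := e3 i
    simp at this
    simpa [hβ] using this
  set lam : ℂ := ((1 + β) * z - β - z ^ 2) / (α * z) with hlam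
  have e4 : Q.map (algebraMap ℝ ℂ) *ᵥ v = lam • v := by
    ext i
    have := e3 i
    simp only [Pi.smul_apply, smul_eq_mul, hlam]
    field_simp
    linear_combination -this
  have hs : lam ∈ spectrum ℂ (Q.map (algebraMap ℝ ℂ)) := by
    rw [← Matrix.spectrum_toLin', ← Module.End.hasEigenvalue_iff_mem_spectrum]
    exact Module.End.hasEigenvalue_of_hasEigenvector
      (x := v) ⟨Module.End.mem_eigenspace_iff.2 (by rw [Matrix.toLin'_apply]; exact e4), hv⟩
  rw [Matrix.mem_spectrum_iff_isRoot_charpoly, Matrix.charpoly_map, hQ.1.charpoly_eq] at hs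
  simp [Polynomial.eval_prod, Polynomial.map_prod, Finset.prod_eq_zero_iff, sub_eq_zero] at hs
  obtain ⟨i, hi⟩ := hs
  refine ⟨_, hQ.1.eigenvalues_mem_spectrum_real i, ?_⟩
  push_cast
  rw [← hi, hlam]
  field_simp
  ring

/-- the robustly stable heavy-ball parameters achieve the best robustness
level `1/√(2μ)` and the rate `1 − a(κ)/√κ`. -/
theorem robustly_stable_heavy_ball (μ L : ℝ) (hμ : 0 < μ) (hμL : μ < L) :
    (aRS (L / μ) ^ 2 / L) / Real.sqrt 2 *
        max (Real.sqrt μ / rCoef (aRS (L / μ) ^ 2 / L) ((1 - aRS (L / μ) / Real.sqrt (L / μ)) ^ 2) 0 μ)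
            (Real.sqrt L / rCoef (aRS (L / μ) ^ 2 / L) ((1 - aRS (L / μ) / Real.sqrt (L / μ)) ^ 2) 0 L)
      = 1 / Real.sqrt (2 * μ) ∧
    ∀ (d : ℕ), 1 ≤ d → ∀ Q : Matrix (Fin d) (Fin d) ℝ, Q.IsSymm → Q.PosDef →
      μ ∈ spectrum ℝ Q → L ∈ spectrum ℝ Q → (∀ t ∈ spectrum ℝ Q, μ ≤ t ∧ t ≤ L) →
      spectralRadius ℂ
          ((AQmat (aRS (L / μ) ^ 2 / L) ((1 - aRS (L / μ) / Real.sqrt (L / μ)) ^ 2) 0 Q).map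
            (algebraMap ℝ ℂ))
        = ENNReal.ofReal (1 - aRS (L / μ) / Real.sqrt (L / μ)) := by
  have hL : 0 < L := hμ.trans hμL
  have hκ : 1 < L / μ := by rw [lt_div_iff₀ hμ]; linarith
  obtain ⟨ha0, hq0, hq1, hsq, hor⟩ := hb_facts (L / μ) hκ
  have hsκ : √(L / μ) = √L / √μ := Real.sqrt_div hL.le _
  have haq : aRS (L / μ) = √(L / μ) * (aRS (L / μ) / √(L / μ)) := by
    have : √(L / μ) ≠ 0 := (Real.sqrt_pos.2 (by positivity)).ne'
    field_simp
  set a := aRS (L / μ) with ha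
  set q := a / √(L / μ) with hq
  have hαμ : a ^ 2 / L * μ = q ^ 2 := by rw [hsq]; field_simp
  have hαL : a ^ 2 / L * L = a ^ 2 := by field_simp
  have hα0 : 0 < a ^ 2 / L := by positivity
  have hμs : 0 < √μ := Real.sqrt_pos.2 hμ
  have hLs : 0 < √L := Real.sqrt_pos.2 hL
  constructor
  · rw [hb_rmu _ q μ hq0 hq1 hαμ]
    have hr := hb_rL _ q a L hq0 hq1 ha0 hαL hor
    set r := rCoef (a ^ 2 / L) ((1 - q) ^ 2) 0 L
    have hr0 : 0 < r := lt_of_lt_of_le (by positivity) hr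
    rw [max_eq_left]
    · rw [show a ^ 2 / L = q ^ 2 / μ by rw [← hαμ]; field_simp, Real.sqrt_mul (by norm_num)]
      have : √μ ^ 2 = μ := Real.sq_sqrt hμ.le
      field_simp
      rw [this]
    · rw [div_le_div_iff₀ hr0 (by positivity)]
      calc √L * q ^ 2 = √μ * (a * q) := by
            rw [haq, hsκ]; field_simp
        _ ≤ _ := by gcongr
  · intro d hd Q _ hQ _ _ hsp
    have hq' : 0 < 1 - q := by linarith
    have key : ∀ z ∈ spectrum ℂ ((AQmat (a ^ 2 / L) ((1 - q) ^ 2) 0 Q).map (algebraMap ℝ ℂ)),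
        ‖z‖ = 1 - q := by
      intro z hz
      obtain ⟨t, ht, hzt⟩ := hb_eig _ _ hα0.ne' (by positivity) Q hQ z hz
      obtain ⟨h1, h2⟩ := hsp t ht
      have h3 := mul_le_mul_of_nonneg_left h1 hα0.le
      have h4 := mul_le_mul_of_nonneg_left h2 hα0.le
      rw [hαμ] at h3
      rw [hαL] at h4
      have h5 : a ^ 2 ≤ 1 + (1 - q) ^ 2 := by
        rcases hor with h | h
        · rw [h]; nlinarith
        · exact h.le
      have h6 : (a ^ 2 / L * t - (1 + (1 - q) ^ 2)) ^ 2 ≤ 4 * (1 - q) ^ 2 := by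
        rw [show 4 * (1 - q) ^ 2 = (2 * (1 - q)) ^ 2 by ring]
        apply sq_le_sq'
        · linarith
        · linarith
      have := hb_root _ _ h6 z hzt
      exact (pow_left_inj₀ (norm_nonneg z) hq'.le two_ne_zero).1 this
    haveI : Nonempty (Fin d) := ⟨⟨0, hd⟩⟩
    obtain ⟨z, hz⟩ := spectrum.nonempty_of_isAlgClosed_of_finiteDimensional ℂ
      ((AQmat (a ^ 2 / L) ((1 - q) ^ 2) 0 Q).map (algebraMap ℝ ℂ))
    have key2 : ∀ z ∈ spectrum ℂ ((AQmat (a ^ 2 / L) ((1 - q) ^ 2) 0 Q).map (algebraMap ℝ ℂ)),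
        (‖z‖₊ : ENNReal) = ENNReal.ofReal (1 - q) := by
      intro z hz
      rw [← key z hz, ofReal_norm_eq_enorm]; rfl
    unfold spectralRadius
    apply le_antisymm
    · exact iSup₂_le fun z hz => (key2 z hz).le
    · rw [← key2 z hz]
      exact le_iSup₂ (f := fun (k : ℂ) (_ : k ∈ spectrum ℂ
        ((AQmat (a ^ 2 / L) ((1 - q) ^ 2) 0 Q).map (algebraMap ℝ ℂ))) => (‖k‖₊ : ENNReal)) z hz
end

section
/- For every real κ ≥ 32, setting a := √κ·(√(2κ−1) − 1)/(κ − 1), one has 4 − a² − 4a/√κ + a/κ > 0 and 2·(1 − a/√κ) ≤ (2 − a/√κ)·√(1 − 1/κ)·√(4 − a² − 4a/√κ + a/κ). -/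
/-- the key inequality showing that the robustly stable heavy-ball
parameters achieve the optimal robustness level. -/
theorem rs_hb_key_inequality (κ : ℝ) (hκ : 32 ≤ κ) :
    0 < 4 - (Real.sqrt κ * (Real.sqrt (2 * κ - 1) - 1) / (κ - 1)) ^ 2
        - 4 * (Real.sqrt κ * (Real.sqrt (2 * κ - 1) - 1) / (κ - 1)) / Real.sqrt κ
        + (Real.sqrt κ * (Real.sqrt (2 * κ - 1) - 1) / (κ - 1)) / κ ∧
    2 * (1 - (Real.sqrt κ * (Real.sqrt (2 * κ - 1) - 1) / (κ - 1)) / Real.sqrt κ) ≤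
      (2 - (Real.sqrt κ * (Real.sqrt (2 * κ - 1) - 1) / (κ - 1)) / Real.sqrt κ) *
        Real.sqrt (1 - 1 / κ) *
        Real.sqrt (4 - (Real.sqrt κ * (Real.sqrt (2 * κ - 1) - 1) / (κ - 1)) ^ 2
          - 4 * (Real.sqrt κ * (Real.sqrt (2 * κ - 1) - 1) / (κ - 1)) / Real.sqrt κ
          + (Real.sqrt κ * (Real.sqrt (2 * κ - 1) - 1) / (κ - 1)) / κ) := by
  obtain ⟨s, hs⟩ : ∃ s, s = Real.sqrt (2 * κ - 1) := ⟨_, rfl⟩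
  obtain ⟨r, hr⟩ : ∃ r, r = Real.sqrt κ := ⟨_, rfl⟩
  have hs0 : 0 ≤ s := hs ▸ Real.sqrt_nonneg _
  have hs2 : s ^ 2 = 2 * κ - 1 := by rw [hs]; exact Real.sq_sqrt (by linarith)
  have hr0 : 0 < r := by rw [hr]; exact Real.sqrt_pos.mpr (by linarith)
  have hr2 : r ^ 2 = κ := by rw [hr]; exact Real.sq_sqrt (by linarith)
  have hs7 : 7 < s := by nlinarith
  have hk : κ = (s ^ 2 + 1) / 2 := by linarith
  have hq : r * (s - 1) / (κ - 1) = r * (2 / (s + 1)) := by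
    have h1 : κ - 1 ≠ 0 := by linarith
    have h2 : s + 1 ≠ 0 := by linarith
    field_simp
    linear_combination hs2
  rw [← hs, ← hr, hq]
  have hu : r * (2 / (s + 1)) / r = 2 / (s + 1) := by field_simp
  have hD : (2 * s ^ 2 - 6) / (s + 1) ^ 2 ≤ 4 - (r * (2 / (s + 1))) ^ 2
      - 4 * (r * (2 / (s + 1))) / r + r * (2 / (s + 1)) / κ := by
    have h0 : 0 < κ := by linarith
    have h3 : 0 ≤ r * (2 / (s + 1)) / κ := by positivity
    have h4 : (2 * s ^ 2 - 6) / (s + 1) ^ 2 = 4 - (r * (2 / (s + 1))) ^ 2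
      - 4 * (r * (2 / (s + 1))) / r := by
      rw [mul_div_assoc, hu, mul_pow, hr2, hk]
      field_simp
      ring
    linarith
  rw [hu]
  generalize 4 - (r * (2 / (s + 1))) ^ 2
      - 4 * (r * (2 / (s + 1))) / r + r * (2 / (s + 1)) / κ = D at hD ⊢
  have hDpos : 0 < D := lt_of_lt_of_le (div_pos (by nlinarith) (by positivity)) hD
  refine ⟨hDpos, ?_⟩
  have e1 : 2 * (1 - 2 / (s + 1)) = 2 * (s - 1) / (s + 1) := by field_simp; ring
  have e2 : 2 - 2 / (s + 1) = 2 * s / (s + 1) := by field_simp; ring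
  have e3 : 1 - 1 / κ = (s ^ 2 - 1) / (s ^ 2 + 1) := by rw [hk]; field_simp; ring
  rw [e1, e2, e3]
  have h5 : 0 ≤ (s ^ 2 - 1) / (s ^ 2 + 1) := div_nonneg (by nlinarith) (by positivity)
  rw [mul_assoc, ← Real.sqrt_mul h5, mul_div_right_comm, mul_div_right_comm 2 s,
    mul_assoc]
  refine mul_le_mul_of_nonneg_left ?_ (by positivity)
  refine abs_le_of_sq_le_sq' ?_ (by positivity) |>.2
  rw [mul_pow, Real.sq_sqrt (mul_nonneg h5 hDpos.le), div_mul_eq_mul_div, mul_div_assoc', le_div_iff₀ (by positivity)]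
  rw [div_le_iff₀ (by positivity)] at hD
  have h6 : s ^ 4 - 1 ≤ s ^ 2 * (D * (s + 1) ^ 2) := by
    have := mul_le_mul_of_nonneg_left hD (sq_nonneg s)
    nlinarith
  have h7 : 0 ≤ (s - 1) / (s + 1) := div_nonneg (by linarith) (by linarith)
  have h8 := mul_le_mul_of_nonneg_left h6 h7
  have e4 : (s - 1) / (s + 1) * (s ^ 4 - 1) = (s - 1) ^ 2 * (s ^ 2 + 1) := by field_simp; ring
  have e5 : (s - 1) / (s + 1) * (s ^ 2 * (D * (s + 1) ^ 2)) = s ^ 2 * ((s ^ 2 - 1) * D) := by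
    field_simp; ring
  linarith
end

section
/- Assume the spectral radius of A_Q is strictly less than 1, and let λ_* ∈ {μ, L} satisfy √(λ_*)/r_{λ_*} = max(√μ/r_μ, √L/r_L). If c_{λ_*} ≤ 0 or |b_{λ_*}·(1 + c_{λ_*})| ≥ 4|c_{λ_*}|, then r_ℝ = r_ℂ = 1/H∞. -/
open Matrix
open scoped Matrix.Norms.L2Operator

/-- The (complex) GMM system matrix `A_Q` built from the eigendecomposition `Q = UΛUᵀ`. -/
noncomputable def AQc {d : ℕ} (α β ν : ℝ) (Q : Matrix (Fin d) (Fin d) ℝ) :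
    Matrix (Fin d ⊕ Fin d) (Fin d ⊕ Fin d) ℂ :=
  Matrix.fromBlocks
    ((1 + β : ℂ) • (1 : Matrix (Fin d) (Fin d) ℂ)
      - ((α * (1 + ν) : ℝ) : ℂ) • (Q.map Complex.ofReal))
    ((-(β : ℂ)) • (1 : Matrix (Fin d) (Fin d) ℂ)
      + ((α * ν : ℝ) : ℂ) • (Q.map Complex.ofReal))
    (1 : Matrix (Fin d) (Fin d) ℂ) (0 : Matrix (Fin d) (Fin d) ℂ)

/-- The (complex) GMM input matrix `B = [−αI; 0]`. -/
noncomputable def Bc {d : ℕ} (α : ℝ) : Matrix (Fin d ⊕ Fin d) (Fin d) ℂ :=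
  Matrix.fromRows ((-(α : ℂ)) • (1 : Matrix (Fin d) (Fin d) ℂ)) 0

/-- The (complex) GMM output matrix `T = (1/√2)·[Λ^{1/2}Uᵀ, 0]`. -/
noncomputable def Tc {d : ℕ} (lam : Fin d → ℝ) (U : Matrix (Fin d) (Fin d) ℝ) :
    Matrix (Fin d) (Fin d ⊕ Fin d) ℂ :=
  ((1 / Real.sqrt 2 : ℝ) : ℂ) • Matrix.fromCols
    ((Matrix.diagonal fun j => ((Real.sqrt (lam j) : ℝ) : ℂ)) * (U.map Complex.ofReal)ᵀ) 0

/-- The complex stability radius of the GMM system `(A_Q, B, T)`. -/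
noncomputable def rComplex {d : ℕ} (α β ν : ℝ) (Q : Matrix (Fin d) (Fin d) ℝ)
    (lam : Fin d → ℝ) (U : Matrix (Fin d) (Fin d) ℝ) : ℝ :=
  sInf {ε : ℝ | ∃ Δ : Matrix (Fin d) (Fin d) ℂ, ‖Δ‖ = ε ∧
    1 ≤ spectralRadius ℂ (AQc α β ν Q + Bc (d := d) α * Δ * Tc lam U)}

/-- The real stability radius of the GMM system `(A_Q, B, T)`. -/
noncomputable def rReal {d : ℕ} (α β ν : ℝ) (Q : Matrix (Fin d) (Fin d) ℝ)
    (lam : Fin d → ℝ) (U : Matrix (Fin d) (Fin d) ℝ) : ℝ :=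
  sInf {ε : ℝ | ∃ Δ : Matrix (Fin d) (Fin d) ℝ, ‖Δ‖ = ε ∧
    1 ≤ spectralRadius ℂ (AQc α β ν Q + Bc (d := d) α * (Δ.map Complex.ofReal) * Tc lam U)}

noncomputable def ffun (β ν s y : ℝ) : ℝ :=
  s^2 - 2*s*(1+(β-ν*s))*y + 2*y*((1-(β-ν*s))^2+2*(β-ν*s)*y)

lemma local_min_aux (a1 a2 a3 δ : ℝ) (hδ : 0 < δ)
    (h : ∀ τ : ℝ, |τ| ≤ δ → 0 ≤ a1*τ + a2*τ^2 + a3*τ^3) : a1 = 0 ∧ 0 ≤ a2 := by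
  have h1 : a1 = 0 := by
    by_contra hne
    have hc : Filter.Tendsto (fun τ : ℝ => a1 + a2*τ + a3*τ^2) (nhds 0) (nhds a1) := by
      have : Continuous (fun τ : ℝ => a1 + a2*τ + a3*τ^2) := by fun_prop
      simpa using this.tendsto 0
    obtain ⟨ε, hε, hb⟩ := Metric.tendsto_nhds_nhds.1 hc |a1| (abs_pos.2 hne)
    set m := min δ (ε/2) with hm
    have hmp : 0 < m := lt_min hδ (by linarith)
    have hmδ : m ≤ δ := min_le_left _ _
    have hmε : m < ε := lt_of_le_of_lt (min_le_right _ _) (by linarith)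
    have e1 := h m (by rw [abs_of_pos hmp]; exact hmδ)
    have e2 := h (-m) (by rw [abs_neg, abs_of_pos hmp]; exact hmδ)
    have f1 := @hb m (by simpa [abs_of_pos hmp] using hmε)
    have f2 := @hb (-m) (by simpa [abs_of_pos hmp] using hmε)
    rw [Real.dist_eq] at f1 f2
    have e1' : 0 ≤ a1 + a2*m + a3*m^2 := by
      by_contra hh; push Not at hh; nlinarith
    have e2' : a1 + a2*(-m) + a3*(-m)^2 ≤ 0 := by
      by_contra hh; push Not at hh; nlinarith
    rcases lt_or_gt_of_ne hne with hl | hl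
    · rw [abs_of_neg hl, abs_lt] at f1; linarith
    · rw [abs_of_pos hl, abs_lt] at f2; linarith
  refine ⟨h1, ?_⟩
  subst h1
  by_contra hneg
  push Not at hneg
  have e1 := h
  set m := min δ (-a2/(2*(|a3|+1))) with hm
  have hq : 0 < -a2/(2*(|a3|+1)) := by
    apply div_pos (by linarith); positivity
  have hmp : 0 < m := lt_min hδ hq
  have hmδ : m ≤ δ := min_le_left _ _
  have hmε : m ≤ -a2/(2*(|a3|+1)) := min_le_right _ _
  have e1 := h m (by rw [abs_of_pos hmp]; exact hmδ)
  rw [le_div_iff₀ (by positivity)] at hmε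
  have e2 : 0 ≤ a2 + a3*m := by
    by_contra hh; push Not at hh
    nlinarith [mul_pos hmp hmp]
  nlinarith [le_abs_self a3, abs_nonneg a3]

lemma P_pos (c s : ℝ) (hc : 0 < c) (hc1 : c < 1) (hs : 1 - c ≤ s) (hs2 : s < 1 + 3*c) :
    0 < (s^2-(1-c)^2)^2*((1-c^2-s)^2-2*c^2*((1+c)*s-(1-c)^2))
      - 2*(s^2-(1-c)^2)*(s*((1+c)*s-(1-c)^2)*(1+3*c-s))*(1+c+2*c^2-(1+c)*s)
      + (s*((1+c)*s-(1-c)^2)*(1+3*c-s))^2 := by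
  obtain ⟨t, ht⟩ : ∃ t, s = 1 - c + 4*c*t := ⟨(s-(1-c))/(4*c), by field_simp; ring⟩
  have ht0 : 0 ≤ t := by
    by_contra h; push Not at h; nlinarith
  have ht1 : 0 < 1 - t := by
    by_contra h; push Not at h; nlinarith
  have he : 0 < 1 - c := by linarith
  subst ht
  have key : ((1 - c + 4*c*t)^2-(1-c)^2)^2*((1-c^2-(1 - c + 4*c*t))^2-2*c^2*((1+c)*(1 - c + 4*c*t)-(1-c)^2))
      - 2*((1 - c + 4*c*t)^2-(1-c)^2)*((1 - c + 4*c*t)*((1+c)*(1 - c + 4*c*t)-(1-c)^2)*(1+3*c-(1 - c + 4*c*t)))*(1+c+2*c^2-(1+c)*(1 - c + 4*c*t))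
      + ((1 - c + 4*c*t)*((1+c)*(1 - c + 4*c*t)-(1-c)^2)*(1+3*c-(1 - c + 4*c*t)))^2
      = 64*c^4*(192*c^4*(1-c)^0*t^5*(1-t)^1 + 48*c^3*(1-c)^1*t^6*(1-t)^0 + 416*c^3*(1-c)^1*t^5*(1-t)^1 + 240*c^3*(1-c)^1*t^4*(1-t)^2 + 84*c^2*(1-c)^2*t^6*(1-t)^0 + 376*c^2*(1-c)^2*t^5*(1-t)^1 + 388*c^2*(1-c)^2*t^4*(1-t)^2 + 112*c^2*(1-c)^2*t^3*(1-t)^3 + 16*c^2*(1-c)^2*t^2*(1-t)^4 + 48*c^1*(1-c)^3*t^6*(1-t)^0 + 168*c^1*(1-c)^3*t^5*(1-t)^1 + 216*c^1*(1-c)^3*t^4*(1-t)^2 + 128*c^1*(1-c)^3*t^3*(1-t)^3 + 40*c^1*(1-c)^3*t^2*(1-t)^4 + 8*c^1*(1-c)^3*t^1*(1-t)^5 + 9*c^0*(1-c)^4*t^6*(1-t)^0 + 30*c^0*(1-c)^4*t^5*(1-t)^1 + 43*c^0*(1-c)^4*t^4*(1-t)^2 + 36*c^0*(1-c)^4*t^3*(1-t)^3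 + 19*c^0*(1-c)^4*t^2*(1-t)^4 + 6*c^0*(1-c)^4*t^1*(1-t)^5 + 1*c^0*(1-c)^4*t^0*(1-t)^6) := by ring
  rw [key]
  have h1 : 0 < c^0*(1-c)^4*t^0*(1-t)^6 := by positivity
  positivity

lemma crit_aux (c s ν y : ℝ) (hc1 : c < 1) (hs : 0 < s) (hν : 0 ≤ ν) (hy : 0 < y)
    (h1 : 4*c*y = (1+c)*s - (1-c)^2)
    (h2 : s^2 + 2*ν*s*y*(s+2*(1-c)-2*y) = 2*y*((1-c)^2+2*c*y))
    (hc : 0 ≤ c)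
    (h3 : (-2*(1+c)+2*ν*(s+2*(1-c)-4*y))^2 ≤ 16*(1+2*ν*(1+ν)*y)*c) : False := by
  have he : 0 < 1 - c := by linarith
  rcases hc.eq_or_lt with h0 | hc0
  · subst h0
    have hs1 : s = 1 := by linarith
    subst hs1
    have h4 : (-2*(1+0)+2*ν*(1+2*(1-0)-4*y)) = 0 := by
      apply pow_eq_zero_iff (two_ne_zero) |>.1; apply le_antisymm _ (sq_nonneg _); linarith
    have h5 : ν*(3-4*y) = 1 := by linarith
    have h6 : 2*y*(3-2*y) = (2*y-1)*(3-4*y) := by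
      linear_combination (3-4*y)*h2 - 2*y*(3-2*y)*h5
    nlinarith [sq_nonneg (2*y-1)]
  · have h4 : 4*ν*s*y*(1+3*c-s) = (1-c)*(s^2-(1-c)^2) := by
      apply mul_left_cancel₀ he.ne'
      linear_combination 4*c*h2 + (4*ν*s*y+4*c*y+(1-c)^2+(1+c)*s)*h1
    have hs1 : 1 - c ≤ s := by
      by_contra h; push Not at h
      have : 0 ≤ 4*ν*s*y*(1+3*c-s) := mul_nonneg (by positivity) (by linarith)
      have : 0 < (1-c)*((1-c)^2-s^2) := mul_pos he (by nlinarith)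
      linarith
    have hs2 : s < 1 + 3*c := by
      by_contra h; push Not at h
      have : 0 ≤ 4*ν*s*y*(s-(1+3*c)) := mul_nonneg (by positivity) (by linarith)
      have : 0 < (1-c)*(s^2-(1-c)^2) := mul_pos he (by nlinarith)
      linarith
    have hP := P_pos c s hc0 hc1 hs1 hs2
    have h5 : ν*(s*((1+c)*s-(1-c)^2)*(1+3*c-s)) = c*(1-c)*(s^2-(1-c)^2) := by
      linear_combination c*h4 - ν*s*(1+3*c-s)*h1
    set M := s*((1+c)*s-(1-c)^2)*(1+3*c-s) with hM
    have h6 : ν^2*((1-c^2-s)^2-2*c^2*((1+c)*s-(1-c)^2)) - 2*ν*c*(1-c)*(1+c+2*c^2-(1+c)*s)+c^2*(1-c)^2 ≤ 0 := by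
      have e1 : c*(-2*(1+c)+2*ν*(s+2*(1-c)-4*y)) = 2*(ν*(1-c^2-s) - c*(1+c)) := by
        linear_combination (-2*ν)*h1
      have e2 : (2*(ν*(1-c^2-s) - c*(1+c)))^2 ≤ c^2*(16*(1+2*ν*(1+ν)*y)*c) := by
        rw [← e1, mul_pow]; exact mul_le_mul_of_nonneg_left h3 (by positivity)
      have e3 : c^2*(16*(1+2*ν*(1+ν)*y)*c) = 16*c^3 + 8*c^2*ν*(1+ν)*((1+c)*s-(1-c)^2) := by
        linear_combination 8*c^2*ν*(1+ν)*h1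
      have e4 : 4*(ν^2*((1-c^2-s)^2-2*c^2*((1+c)*s-(1-c)^2)) - 2*ν*c*(1-c)*(1+c+2*c^2-(1+c)*s)+c^2*(1-c)^2)
          = (2*(ν*(1-c^2-s) - c*(1+c)))^2 - (16*c^3 + 8*c^2*ν*(1+ν)*((1+c)*s-(1-c)^2)) := by ring
      have e5 : (2*(ν*(1-c^2-s) - c*(1+c)))^2 - (16*c^3 + 8*c^2*ν*(1+ν)*((1+c)*s-(1-c)^2)) ≤ 0 :=
        sub_nonpos.2 (e2.trans e3.le)
      rw [← e4] at e5
      exact nonpos_of_mul_nonpos_right e5 (by norm_num)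
    have h7 := mul_le_mul_of_nonneg_left h6 (sq_nonneg M)
    have h8 : M^2*(ν^2*((1-c^2-s)^2-2*c^2*((1+c)*s-(1-c)^2)) - 2*ν*c*(1-c)*(1+c+2*c^2-(1+c)*s)+c^2*(1-c)^2) = (c*(1-c))^2*((s^2-(1-c)^2)^2*((1-c^2-s)^2-2*c^2*((1+c)*s-(1-c)^2))
      - 2*(s^2-(1-c)^2)*M*(1+c+2*c^2-(1+c)*s) + M^2) := by
      linear_combination ((ν*M+c*(1-c)*(s^2-(1-c)^2))*((1-c^2-s)^2-2*c^2*((1+c)*s-(1-c)^2)) - 2*M*c*(1-c)*(1+c+2*c^2-(1+c)*s))*h5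
    have h9 : 0 < (c*(1-c))^2 := by positivity
    have h10 := mul_pos h9 hP
    rw [h8, mul_zero] at h7
    exact absurd h7 (not_le.2 h10)

lemma ffun_min (β ν s1 s2 κ : ℝ) (hν : 0 ≤ ν) (h1 : 0 < s1)
    (hc1 : β - ν*s1 < 1) (ht2 : s2 < 2*(1+(β-ν*s2)))
    (hm1 : ∀ y, 0 ≤ y → y ≤ 2 → κ*s1 ≤ ffun β ν s1 y)
    (hm2 : ∀ y, 0 ≤ y → y ≤ 2 → κ*s2 ≤ ffun β ν s2 y)
    (s y : ℝ) (hs1 : s1 ≤ s) (hs2 : s ≤ s2) (hy0 : 0 ≤ y) (hy2 : y ≤ 2) :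
    κ*s ≤ ffun β ν s y := by
  by_contra hcon
  push Not at hcon
  have hcpt : IsCompact (Set.Icc s1 s2 ×ˢ Set.Icc (0:ℝ) 2) := isCompact_Icc.prod isCompact_Icc
  have hcont : ContinuousOn (fun p : ℝ × ℝ => ffun β ν p.1 p.2 / p.1) (Set.Icc s1 s2 ×ˢ Set.Icc (0:ℝ) 2) := by
    apply ContinuousOn.div
    · unfold ffun; fun_prop
    · fun_prop
    · rintro ⟨a, b⟩ ⟨ha, _⟩; exact (lt_of_lt_of_le h1 ha.1).ne'
  obtain ⟨⟨a, b⟩, ⟨ha, hb⟩, hmin⟩ := hcpt.exists_isMinOn ⟨(s, y), ⟨⟨hs1, hs2⟩, ⟨hy0, hy2⟩⟩⟩ hcont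
  simp only [Set.mem_Icc] at ha hb
  set k := ffun β ν a b / a with hk
  have hapos : 0 < a := lt_of_lt_of_le h1 ha.1
  have hka : k * a = ffun β ν a b := by rw [hk]; field_simp
  have hmin' : ∀ s' y', s1 ≤ s' → s' ≤ s2 → 0 ≤ y' → y' ≤ 2 → k*s' ≤ ffun β ν s' y' := by
    intro s' y' p1 p2 p3 p4
    have := hmin (⟨⟨p1, p2⟩, ⟨p3, p4⟩⟩ : (s', y') ∈ Set.Icc s1 s2 ×ˢ Set.Icc (0:ℝ) 2)
    simp only [Set.mem_ofPred_eq] at this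
    rwa [le_div_iff₀ (lt_of_lt_of_le h1 p1)] at this
  have hkκ : k < κ := by
    have h0 := hmin' s y hs1 hs2 hy0 hy2
    have : 0 < s := lt_of_lt_of_le h1 hs1
    nlinarith
  have ha1 : s1 < a := by
    rcases ha.1.eq_or_lt with h | h
    · exfalso; have := hm1 b hb.1 hb.2; rw [h] at this; nlinarith
    · exact h
  have ha2 : a < s2 := by
    rcases ha.2.eq_or_lt with h | h
    · exfalso; have := hm2 b hb.1 hb.2; rw [← h] at this; nlinarith
    · exact h
  clear hmin hcont hcpt hcon
  clear_value k
  have hca : β - ν*a < 1 := by nlinarith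
  have hta : a < 2*(1+(β-ν*a)) := by nlinarith
  obtain ⟨c, hc⟩ : ∃ c, c = β - ν*a := ⟨_, rfl⟩
  rw [← hc] at hca hta
  have hβ : β = c + ν*a := by linarith
  -- directional expansion
  have hexp : ∀ h l τ : ℝ, ffun β ν (a+τ*h) (b+τ*l) - k*(a+τ*h) =
      (h*(2*a-2*(1+c)*b+2*a*ν*b+4*b*(1-c)*ν-4*ν*b^2-k) + l*(-2*a*(1+c)+2*(1-c)^2+8*c*b))*τ
      + ((1+2*ν*(1+ν)*b)*h^2 + (-2*(1+c)+2*ν*(a+2*(1-c)-4*b))*h*l + 4*c*l^2)*τ^2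
      + ((2*ν+2*ν^2)*h^2*l - 4*ν*h*l^2)*τ^3 := by
    intro h l τ
    have := hka
    unfold ffun at this ⊢
    rw [hβ] at this ⊢
    linear_combination -this
  have hδa : 0 < min (a - s1) (s2 - a) := lt_min (by linarith) (by linarith)
  have hS := local_min_aux _ _ _ _ hδa (fun τ hτ => by
    have hτ1 := (abs_le.1 (hτ.trans (min_le_left _ _)))
    have hτ2 := (abs_le.1 (hτ.trans (min_le_right _ _)))
    have e := hmin' (a+τ*1) (b+τ*0) (by linarith) (by linarith) (by linarith [hb.1]) (by linarith [hb.2])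
    rw [← sub_nonneg, hexp 1 0 τ] at e
    exact e)
  have hS1 := hS.1
  have hknn : 0 ≤ k * a := by
    rw [hka]
    have : ffun β ν a b = (a - (1+c)*b)^2 + (1-c)^2*(b*(2-b)) := by
      unfold ffun; rw [hβ]; ring
    rw [this]
    have : 0 ≤ b*(2-b) := mul_nonneg hb.1 (by linarith [hb.2])
    positivity
  have hk0 : 0 ≤ k := by
    by_contra h; push Not at h; nlinarith
  rcases hb.1.eq_or_lt with hb0 | hb0
  · rw [← hb0] at hS1 hka
    unfold ffun at hka
    have : a = k := by apply mul_right_cancel₀ hapos.ne'; linarith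
    linarith
  rcases hb.2.eq_or_lt with hb2 | hb2
  · rw [hb2] at hS1
    have hX : 0 < 2*(1+c) - a := by linarith
    have : 0 < (2*(1+c) - a)*(1+2*ν) := by positivity
    have : 2*a-2*(1+c)*2+2*a*ν*2+4*2*(1-c)*ν-4*ν*2^2-k = -2*((2*(1+c) - a)*(1+2*ν)) - k := by ring
    linarith
  have hgen : ∀ h l : ℝ, (h*(2*a-2*(1+c)*b+2*a*ν*b+4*b*(1-c)*ν-4*ν*b^2-k) + l*(-2*a*(1+c)+2*(1-c)^2+8*c*b)) = 0 ∧
      0 ≤ ((1+2*ν*(1+ν)*b)*h^2 + (-2*(1+c)+2*ν*(a+2*(1-c)-4*b))*h*l + 4*c*l^2) := by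
    intro h l
    have hδ : 0 < min (min (a - s1) (s2 - a)) (min b (2-b)) / (|h|+|l|+1) := by
      apply div_pos
      · exact lt_min hδa (lt_min hb0 (by linarith))
      · positivity
    refine local_min_aux _ _ ((2*ν+2*ν^2)*h^2*l - 4*ν*h*l^2) _ hδ (fun τ hτ => ?_)
    rw [le_div_iff₀ (by positivity)] at hτ
    have q1 : |τ*h| ≤ min (min (a - s1) (s2 - a)) (min b (2-b)) := by
      rw [abs_mul]; nlinarith [abs_nonneg τ, abs_nonneg h, abs_nonneg l, mul_nonneg (abs_nonneg τ) (abs_nonneg l)]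
    have q2 : |τ*l| ≤ min (min (a - s1) (s2 - a)) (min b (2-b)) := by
      rw [abs_mul]; nlinarith [abs_nonneg τ, abs_nonneg h, abs_nonneg l, mul_nonneg (abs_nonneg τ) (abs_nonneg h)]
    rw [le_min_iff, le_min_iff, le_min_iff] at q1 q2
    obtain ⟨⟨q3, q4⟩, _⟩ := q1
    obtain ⟨_, q5, q6⟩ := q2
    rw [abs_le] at q3 q4 q5 q6
    have e := hmin' (a+τ*h) (b+τ*l) (by linarith) (by linarith) (by linarith) (by linarith)
    rw [← sub_nonneg, hexp h l τ] at e
    exact e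
  have g1 := (hgen 1 0).1
  have g2 := (hgen 0 1).1
  have g3 := (hgen 0 1).2
  have hc0 : 0 ≤ c := by
    norm_num at g3; exact g3
  set A := 1+2*ν*(1+ν)*b with hA
  have hApos : 0 < A := by positivity
  set S := -2*(1+c)+2*ν*(a+2*(1-c)-4*b) with hSdef
  have g4 := (hgen (-S) (2*A)).2
  have g5 : 0 ≤ A*(16*A*c - S^2) := by
    clear_value A S
    have : A*(16*A*c - S^2) = A*(-S)^2 + S*(-S)*(2*A) + 4*c*(2*A)^2 := by ring
    rw [this]; exact g4
  have g6 : S^2 ≤ 16*A*c := by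
    exact sub_nonneg.1 (nonneg_of_mul_nonneg_right g5 hApos)
  refine crit_aux c a ν b hca hapos hν hb0 (by linear_combination (1/2)*g2) ?_ hc0 g6
  unfold ffun at hka
  rw [hβ] at hka
  linear_combination a*g1 + hka
lemma jury_aux (b c : ℝ) (h : ∀ z : ℂ, z^2 + b*z + c = 0 → ‖z‖ < 1) : c < 1 ∧ |b| < 1 + c := by
  obtain ⟨q, hq⟩ := IsAlgClosed.exists_pow_nat_eq ((b:ℂ)^2 - 4*c) (n := 2) (by norm_num)
  have r1 := h ((-b+q)/2) (by linear_combination (1/4)*hq)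
  have r2 := h ((-b-q)/2) (by linear_combination (1/4)*hq)
  have hc : |c| < 1 := by
    have : ‖((-b+q)/2) * ((-b-q)/2)‖ < 1 := by
      rw [norm_mul]; nlinarith [norm_nonneg ((-b+q)/2), norm_nonneg ((-b-q)/2)]
    have e : ((-b+q)/2) * ((-b-q)/2) = (c:ℂ) := by linear_combination (-1/4)*hq
    rwa [e, Complex.norm_real, Real.norm_eq_abs] at this
  rw [abs_lt] at hc
  refine ⟨hc.2, ?_⟩
  by_cases hD : 0 ≤ b^2 - 4*c
  · have hs := Real.sq_sqrt hD
    set t := Real.sqrt (b^2-4*c) with ht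
    have ht0 : 0 ≤ t := Real.sqrt_nonneg _
    have q1 := h (((-b+t)/2 : ℝ)) (by
      rw [← Complex.ofReal_pow, ← Complex.ofReal_mul, ← Complex.ofReal_add, ← Complex.ofReal_add]
      rw [Complex.ofReal_eq_zero]; linear_combination (1/4)*hs)
    have q2 := h (((-b-t)/2 : ℝ)) (by
      rw [← Complex.ofReal_pow, ← Complex.ofReal_mul, ← Complex.ofReal_add, ← Complex.ofReal_add]
      rw [Complex.ofReal_eq_zero]; linear_combination (1/4)*hs)
    rw [Complex.norm_real, Real.norm_eq_abs, abs_lt] at q1 q2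
    rcases abs_cases b with ⟨hb, _⟩ | ⟨hb, _⟩ <;> rw [hb] <;> nlinarith
  · push Not at hD
    apply abs_lt_of_sq_lt_sq _ (by linarith)
    nlinarith [sq_nonneg (1-c)]

lemma root_growth (r z : ℂ) (hr : ‖r‖ < 1) (hz : 1 ≤ ‖z‖) :
    ‖z‖ * ‖z/‖z‖ - r‖^2 ≤ ‖z - r‖^2 := by
  have hz0 : (‖z‖:ℝ) ≠ 0 := by positivity
  have hzn : z.re^2 + z.im^2 = ‖z‖^2 := by
    rw [← Complex.normSq_eq_norm_sq, Complex.normSq_apply]; ring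
  have hrn : r.re^2 + r.im^2 = ‖r‖^2 := by
    rw [← Complex.normSq_eq_norm_sq, Complex.normSq_apply]; ring
  have hu1 : (z/‖z‖).re = z.re/‖z‖ := Complex.div_ofReal_re z ‖z‖
  have hu2 : (z/‖z‖).im = z.im/‖z‖ := Complex.div_ofReal_im z ‖z‖
  rw [← Complex.normSq_eq_norm_sq, ← Complex.normSq_eq_norm_sq, Complex.normSq_apply, Complex.normSq_apply,
    Complex.sub_re, Complex.sub_im, Complex.sub_re, Complex.sub_im, hu1, hu2]
  set p := ‖z‖
  set q := ‖r‖
  have hq0 : 0 ≤ q := norm_nonneg _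
  have e : p*((z.re/p - r.re)*(z.re/p-r.re) + (z.im/p-r.im)*(z.im/p-r.im)) = p + p*q^2 - 2*(z.re*r.re+z.im*r.im) := by
    rw [← hrn]
    field_simp
    linear_combination hzn
  rw [e]
  have : 0 ≤ (p-1)*(p-q^2) := mul_nonneg (by linarith) (by nlinarith)
  nlinarith

lemma poly_growth (b c : ℝ) (h : ∀ z : ℂ, z^2 + b*z + c = 0 → ‖z‖ < 1) (z : ℂ) (hz : 1 ≤ ‖z‖) :
    ‖z‖ * ‖(z/‖z‖)^2 + b*(z/‖z‖) + c‖ ≤ ‖z^2+b*z+c‖ := by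
  obtain ⟨q, hq⟩ := IsAlgClosed.exists_pow_nat_eq ((b:ℂ)^2 - 4*c) (n := 2) (by norm_num)
  have r1 := h ((-b+q)/2) (by linear_combination (1/4)*hq)
  have r2 := h ((-b-q)/2) (by linear_combination (1/4)*hq)
  have e : ∀ w : ℂ, w^2+b*w+c = (w - (-b+q)/2)*(w-(-b-q)/2) := by
    intro w; linear_combination (1/4)*hq
  rw [e, e, norm_mul, norm_mul]
  have g1 := root_growth _ z r1 hz
  have g2 := root_growth _ z r2 hz
  apply le_of_sq_le_sq _ (by positivity)
  have := mul_le_mul g1 g2 (by positivity) (by positivity)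
  nlinarith

lemma norm_unit (β ν s : ℝ) (u : ℂ) (hu : ‖u‖ = 1) :
    ‖u^2 + ((s - (1+(β-ν*s)) : ℝ):ℂ)*u + ((β-ν*s : ℝ):ℂ)‖^2 = ffun β ν s (1-u.re) := by
  have hun : u.re^2 + u.im^2 = 1 := by
    have : u.re^2 + u.im^2 = ‖u‖^2 := by
      rw [← Complex.normSq_eq_norm_sq, Complex.normSq_apply]; ring
    rw [this, hu]; norm_num
  rw [← Complex.normSq_eq_norm_sq, Complex.normSq_apply]
  unfold ffun
  generalize β-ν*s = c
  simp only [Complex.add_re, Complex.add_im, Complex.ofReal_re, Complex.ofReal_im, pow_two, Complex.mul_re, Complex.mul_im]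
  have hi : u.im^2 = 1 - u.re^2 := by linarith
  have e : ∀ x y b : ℝ, (x*x-y*y+(b*x-0*y)+c)*(x*x-y*y+(b*x-0*y)+c) + (x*y+y*x+(b*y+0*x)+0)*(x*y+y*x+(b*y+0*x)+0)
     = (x^2-y^2+b*x+c)^2 + y^2*(2*x+b)^2 := by intros; ring
  rw [e, hi]
  ring

lemma rCoef_spec (α β ν lam : ℝ) (hc : cCoef α β ν lam < 1)
    (hb : |bCoef α β ν lam| < 1 + cCoef α β ν lam) :
    0 < rCoef α β ν lam ∧ ∀ y, 0 ≤ y → y ≤ 2 → (rCoef α β ν lam)^2 ≤ ffun β ν (α*lam) y := by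
  have hs : α*lam = bCoef α β ν lam + (1 + cCoef α β ν lam) := by
    unfold bCoef cCoef; ring
  have hf : ∀ y, ffun β ν (α*lam) y = 4*cCoef α β ν lam*(1-y)^2 + 2*bCoef α β ν lam*(1+cCoef α β ν lam)*(1-y) + (bCoef α β ν lam)^2 + (1-cCoef α β ν lam)^2 := by
    intro y
    have : β - ν*(α*lam) = cCoef α β ν lam := by unfold cCoef; ring
    unfold ffun; rw [this, hs]; ring
  simp only [hf]
  unfold rCoef
  generalize bCoef α β ν lam = b at *
  generalize cCoef α β ν lam = c at *
  have hb0 := abs_nonneg b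
  have hbs := sq_abs b
  split_ifs with h
  · obtain ⟨hc0, hlt⟩ := h
    rw [div_lt_one (by positivity)] at hlt
    have h4 : b^2 < 4*c := by nlinarith
    have h5 : 0 < 1 - b^2/(4*c) := by
      rw [sub_pos, div_lt_one (by positivity)]; exact h4
    refine ⟨mul_pos (abs_pos.2 (by linarith)) (Real.sqrt_pos.2 h5), fun y _ _ => ?_⟩
    rw [mul_pow, sq_abs, Real.sq_sqrt h5.le]
    have : 4*c*(1-y)^2 + 2*b*(1+c)*(1-y) + b^2 + (1-c)^2 - (1-c)^2*(1-b^2/(4*c)) = (4*c*(1-y)+b*(1+c))^2/(4*c) := by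
      field_simp; ring
    have h6 : 0 ≤ (4*c*(1-y)+b*(1+c))^2/(4*c) := by positivity
    linarith
  · have h1c : 0 < 1 + c := by linarith
    rw [abs_of_pos h1c]
    refine ⟨abs_pos.2 (by linarith), fun y hy0 hy2 => ?_⟩
    rw [sq_abs]
    have hx : |1-y| ≤ 1 := abs_le.2 ⟨by linarith, by linarith⟩
    have hx2 := sq_abs (1-y)
    have hx0 := abs_nonneg (1-y)
    have hbx : -(|b| * |1-y|) ≤ b*(1-y) := by rw [← abs_mul]; exact neg_abs_le _
    generalize 1-y = x at *
    have key : 4*c*(1-x^2) ≤ 2*(1+c)*(|b| * (1-|x|)) := by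
      by_cases hc0 : 0 < c
      · have h2 : ¬ (|b| * (1+c)/(4*c) < 1) := fun h3 => h ⟨hc0, h3⟩
        rw [div_lt_one (by positivity), not_lt] at h2
        have h3 := mul_le_mul_of_nonneg_right h2 (sub_nonneg.2 hx)
        have h4 : 4*c*(1-x^2) ≤ 2*(4*c*(1-|x|)) := by
          rw [← hx2]; nlinarith [mul_nonneg hc0.le (sq_nonneg (1-|x|))]
        linarith
      · push Not at hc0
        have h3 : 0 ≤ 1 - x^2 := by rw [← hx2]; nlinarith
        have h4 : 0 ≤ 2*(1+c)*(|b| * (1-|x|)) := mul_nonneg (by positivity) (mul_nonneg hb0 (by linarith))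
        nlinarith
    have := mul_le_mul_of_nonneg_left hbx h1c.le
    nlinarith

lemma main_scalar (α β ν μ L lam : ℝ) (hα : 0 < α) (hν : 0 ≤ ν) (hμ : 0 < μ)
    (h1 : μ ≤ lam) (h2 : lam ≤ L)
    (hst : ∀ l ∈ ({μ, L, lam} : Set ℝ), ∀ z : ℂ, z^2 + (bCoef α β ν l : ℝ)*z + (cCoef α β ν l : ℝ) = 0 → ‖z‖ < 1)
    (κ : ℝ) (hκ0 : 0 ≤ κ) (hκ1 : κ * Real.sqrt μ ≤ rCoef α β ν μ) (hκ2 : κ * Real.sqrt L ≤ rCoef α β ν L)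
    (z : ℂ) (hz : 1 ≤ ‖z‖) :
    ‖z‖ * (κ * Real.sqrt lam) ≤ ‖z^2 + (bCoef α β ν lam : ℝ)*z + (cCoef α β ν lam : ℝ)‖ := by
  have j1 := jury_aux _ _ (hst μ (by simp))
  have j2 := jury_aux _ _ (hst L (by simp))
  have hlam : 0 < lam := by linarith
  have hL : 0 < L := by linarith
  have r1 := rCoef_spec α β ν μ j1.1 j1.2
  have r2 := rCoef_spec α β ν L j2.1 j2.2
  refine le_trans ?_ (poly_growth _ _ (hst lam (by simp)) z hz)
  refine mul_le_mul_of_nonneg_left ?_ (norm_nonneg _)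
  have hz0 : ‖z‖ ≠ 0 := by positivity
  set u : ℂ := z/‖z‖ with hu
  have hun : ‖u‖ = 1 := by
    rw [hu, norm_div, Complex.norm_real, norm_norm, div_self hz0]
  have hre := Complex.abs_re_le_norm u
  rw [hun, abs_le] at hre
  have e1 : bCoef α β ν lam = α*lam - (1+(β-ν*(α*lam))) := by unfold bCoef; ring
  have e2 : cCoef α β ν lam = β-ν*(α*lam) := by unfold cCoef; ring
  have e3 : ∀ l, cCoef α β ν l = β-ν*(α*l) := by intro l; unfold cCoef; ring
  have e4 : ∀ l, bCoef α β ν l = α*l - (1+(β-ν*(α*l))) := by intro l; unfold bCoef; ring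
  apply le_of_sq_le_sq _ (norm_nonneg _)
  rw [e1, e2, norm_unit _ _ _ _ hun, mul_pow, Real.sq_sqrt hlam.le]
  have hm := ffun_min β ν (α*μ) (α*L) (κ^2/α) hν (by positivity)
    (by rw [← e3]; exact j1.1)
    (by have := (abs_lt.1 j2.2).2; rw [e4, e3] at this; linarith)
    (fun y hy0 hy2 => by
      refine le_trans ?_ (r1.2 y hy0 hy2)
      have : κ^2/α*(α*μ) = (κ * Real.sqrt μ)^2 := by
        rw [mul_pow, Real.sq_sqrt hμ.le]; field_simp
      rw [this]
      exact pow_le_pow_left₀ (by positivity) hκ1 2)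
    (fun y hy0 hy2 => by
      refine le_trans ?_ (r2.2 y hy0 hy2)
      have : κ^2/α*(α*L) = (κ * Real.sqrt L)^2 := by
        rw [mul_pow, Real.sq_sqrt hL.le]; field_simp
      rw [this]
      exact pow_le_pow_left₀ (by positivity) hκ2 2)
    (α*lam) (1-u.re) (by gcongr) (by gcongr) (by linarith) (by linarith)
  have : κ^2/α*(α*lam) = κ^2*lam := by field_simp
  rwa [this] at hm

lemma mem_spectrum_iff_vec {n : Type*} [Fintype n] [DecidableEq n] (M : Matrix n n ℂ) (z : ℂ) :
    z ∈ spectrum ℂ M ↔ ∃ v, v ≠ 0 ∧ M *ᵥ v = z • v := by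
  rw [spectrum.mem_iff, Matrix.isUnit_iff_isUnit_det, isUnit_iff_ne_zero, not_not,
    ← Matrix.exists_mulVec_eq_zero_iff]
  refine exists_congr fun v => and_congr_right fun _ => ?_
  rw [Matrix.sub_mulVec, sub_eq_zero, Algebra.algebraMap_eq_smul_one, Matrix.smul_mulVec, Matrix.one_mulVec]
  exact eq_comm

lemma M_mulVec {d : ℕ} (α β ν : ℝ) (Q U : Matrix (Fin d) (Fin d) ℝ) (lam : Fin d → ℝ)
    (Δ : Matrix (Fin d) (Fin d) ℂ) (v1 v2 : Fin d → ℂ) :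
    (AQc α β ν Q + Bc (d := d) α * Δ * Tc lam U) *ᵥ Sum.elim v1 v2 =
    Sum.elim ((1 + β : ℂ) • v1 - ((α * (1 + ν) : ℝ) : ℂ) • (Q.map Complex.ofReal *ᵥ v1)
      + (-(β : ℂ)) • v2 + ((α * ν : ℝ) : ℂ) • (Q.map Complex.ofReal *ᵥ v2)
      + (-(α : ℂ)) • (Δ *ᵥ (((1 / Real.sqrt 2 : ℝ) : ℂ) •
        ((Matrix.diagonal fun j => ((Real.sqrt (lam j) : ℝ) : ℂ)) *ᵥ ((U.map Complex.ofReal)ᵀ *ᵥ v1))))) v1 := by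
  rw [Matrix.add_mulVec, ← Matrix.mulVec_mulVec, ← Matrix.mulVec_mulVec]
  unfold AQc Bc Tc
  rw [Matrix.smul_mulVec, Matrix.fromCols_mulVec_sumElim, Matrix.fromRows_mulVec, Matrix.fromBlocks_mulVec]
  simp only [Sum.elim_comp_inl, Sum.elim_comp_inr, Matrix.add_mulVec, Matrix.sub_mulVec, Matrix.smul_mulVec,
    Matrix.one_mulVec, Matrix.zero_mulVec, add_zero, ← Matrix.mulVec_mulVec]
  ext (i | i)
  · simp only [Pi.add_apply, Sum.elim_inl]; ring
  · simp only [Pi.add_apply, Sum.elim_inr, Pi.zero_apply, add_zero]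

lemma Umap_mul {d : ℕ} (U : Matrix (Fin d) (Fin d) ℝ) (hU : U * Uᵀ = 1) :
    (U.map Complex.ofReal) * (U.map Complex.ofReal)ᵀ = 1 ∧
    (U.map Complex.ofReal)ᵀ * (U.map Complex.ofReal) = 1 := by
  have h : (U.map Complex.ofReal) * (U.map Complex.ofReal)ᵀ = 1 := by
    have := congrArg (fun X : Matrix (Fin d) (Fin d) ℝ => X.map Complex.ofRealHom) hU
    simp only [Matrix.map_mul] at this
    rw [Matrix.map_one _ (map_zero _) (map_one _)] at this
    try rw [Matrix.transpose_map] at this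
    exact this
  exact ⟨h, mul_eq_one_comm.1 h⟩

lemma spec_char {d : ℕ} (α β ν : ℝ) (lam : Fin d → ℝ) (U : Matrix (Fin d) (Fin d) ℝ) (hU : U * Uᵀ = 1)
    (Q : Matrix (Fin d) (Fin d) ℝ) (hQ : Q = U * Matrix.diagonal lam * Uᵀ)
    (Δ : Matrix (Fin d) (Fin d) ℂ) (z : ℂ) :
    z ∈ spectrum ℂ (AQc α β ν Q + Bc (d := d) α * Δ * Tc lam U) ↔
    ∃ w : Fin d → ℂ, w ≠ 0 ∧ ∀ j, (z^2 + (bCoef α β ν (lam j) : ℝ)*z + (cCoef α β ν (lam j) : ℝ)) * w j =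
      -((α / Real.sqrt 2 : ℝ) : ℂ) * z *
        (((U.map Complex.ofReal)ᵀ * Δ) *ᵥ (fun i => ((Real.sqrt (lam i) : ℝ) : ℂ) * w i)) j := by
  obtain ⟨hV1, hV2⟩ := Umap_mul U hU
  have hQc : Q.map Complex.ofReal = U.map Complex.ofReal * Matrix.diagonal (fun j => (lam j : ℂ)) * (U.map Complex.ofReal)ᵀ := by
    have := congrArg (fun X : Matrix (Fin d) (Fin d) ℝ => X.map Complex.ofRealHom) hQ
    simp only [Matrix.map_mul] at this
    rw [Matrix.diagonal_map (map_zero _)] at this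
    try rw [Matrix.transpose_map] at this
    exact this
  set V := U.map Complex.ofReal with hV
  have hVinj : ∀ x y : Fin d → ℂ, Vᵀ *ᵥ x = Vᵀ *ᵥ y → x = y := by
    intro x y h
    have := congrArg (fun t => V *ᵥ t) h
    simpa [Matrix.mulVec_mulVec, hV1] using this
  -- key equation
  have key : ∀ w : Fin d → ℂ,
      ((AQc α β ν Q + Bc (d := d) α * Δ * Tc lam U) *ᵥ Sum.elim (z • (V *ᵥ w)) (V *ᵥ w) =
        z • Sum.elim (z • (V *ᵥ w)) (V *ᵥ w)) ↔
      ∀ j, (z^2 + (bCoef α β ν (lam j) : ℝ)*z + (cCoef α β ν (lam j) : ℝ)) * w j =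
      -((α / Real.sqrt 2 : ℝ) : ℂ) * z *
        ((Vᵀ * Δ) *ᵥ (fun i => ((Real.sqrt (lam i) : ℝ) : ℂ) * w i)) j := by
    intro w
    have hd : ∀ (f : Fin d → ℂ), Matrix.diagonal f *ᵥ w = fun i => f i * w i := by
      intro f; ext i; rw [Matrix.mulVec_diagonal]
    have hVV : Vᵀ *ᵥ (V *ᵥ w) = w := by rw [Matrix.mulVec_mulVec, hV2, Matrix.one_mulVec]
    have hQV : Q.map Complex.ofReal *ᵥ (V *ᵥ w) = V *ᵥ (fun i => (lam i : ℂ) * w i) := by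
      rw [hQc, ← Matrix.mulVec_mulVec, hVV, ← Matrix.mulVec_mulVec, hd]
    rw [M_mulVec]
    simp only [Matrix.mulVec_smul, ← hV]
    rw [hVV, hQV, hd]
    have hs : ∀ a b c' : Fin d → ℂ, Sum.elim a (z • c') = z • Sum.elim b c' ↔ a = z • b := by
      intro a b c'
      constructor
      · intro h; ext i; simpa using congrFun h (Sum.inl i)
      · intro h; ext (i | i)
        · simpa using congrFun h i
        · simp
    rw [hs]
    have hi : ∀ x y : Fin d → ℂ, x = y ↔ Vᵀ *ᵥ x = Vᵀ *ᵥ y := fun x y => ⟨fun h => by rw [h], hVinj x y⟩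
    rw [hi, funext_iff]
    refine forall_congr' fun j => ?_
    simp only [Matrix.mulVec_add, Matrix.mulVec_sub, Matrix.mulVec_smul]
    have hVl : Vᵀ *ᵥ (V *ᵥ (fun i => (lam i : ℂ) * w i)) = (fun i => (lam i : ℂ) * w i) := by
      rw [Matrix.mulVec_mulVec, hV2, Matrix.one_mulVec]
    rw [hVV, hVl, Matrix.mulVec_mulVec]
    simp only [Pi.add_apply, Pi.sub_apply, Pi.smul_apply, smul_eq_mul]
    generalize ((Vᵀ * Δ) *ᵥ (fun i => ((Real.sqrt (lam i) : ℝ) : ℂ) * w i)) j = E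
    unfold bCoef cCoef
    push_cast
    constructor
    · intro h; linear_combination -h
    · intro h; linear_combination -h
  rw [mem_spectrum_iff_vec]
  constructor
  · rintro ⟨v, hv, hMv⟩
    obtain ⟨v1, v2, rfl⟩ : ∃ v1 v2 : Fin d → ℂ, v = Sum.elim v1 v2 :=
      ⟨v ∘ Sum.inl, v ∘ Sum.inr, (Sum.elim_comp_inl_inr v).symm⟩
    have h1 : v1 = z • v2 := by
      rw [M_mulVec] at hMv
      ext i; simpa using congrFun hMv (Sum.inr i)
    have h2 : v2 = V *ᵥ (Vᵀ *ᵥ v2) := by rw [Matrix.mulVec_mulVec, hV1, Matrix.one_mulVec]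
    refine ⟨Vᵀ *ᵥ v2, ?_, ?_⟩
    · intro h0
      apply hv
      rw [h0, Matrix.mulVec_zero] at h2
      rw [h1, h2]; ext (i | i) <;> simp
    · rw [← key, ← h2, ← h1]; exact hMv
  · rintro ⟨w, hw, h⟩
    refine ⟨_, ?_, (key w).2 h⟩
    intro h0
    apply hw
    have h3 : V *ᵥ w = 0 := by
      ext i; simpa using congrFun h0 (Sum.inr i)
    have := congrArg (fun t => Vᵀ *ᵥ t) h3
    simpa [Matrix.mulVec_mulVec, hV2] using this

lemma map_norm_le {d : ℕ} (Δ : Matrix (Fin d) (Fin d) ℝ) : ‖Δ.map Complex.ofReal‖ ≤ ‖Δ‖ := by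
  rw [← Matrix.l2_opNorm_toEuclideanCLM]
  refine ContinuousLinearMap.opNorm_le_bound _ (norm_nonneg _) fun x => ?_
  apply le_of_sq_le_sq _ (by positivity)
  rw [mul_pow, EuclideanSpace.norm_sq_eq, EuclideanSpace.norm_sq_eq]
  have hre := Matrix.l2_opNorm_mulVec Δ (WithLp.toLp 2 (fun i => (x i).re))
  have him := Matrix.l2_opNorm_mulVec Δ (WithLp.toLp 2 (fun i => (x i).im))
  have hre2 := pow_le_pow_left₀ (norm_nonneg _) hre 2
  have him2 := pow_le_pow_left₀ (norm_nonneg _) him 2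
  rw [mul_pow, EuclideanSpace.norm_sq_eq, EuclideanSpace.norm_sq_eq] at hre2 him2
  have hc : ∀ t : ℂ, ‖t‖^2 = ‖t.re‖^2 + ‖t.im‖^2 := by
    intro t
    rw [← Complex.normSq_eq_norm_sq, Complex.normSq_apply, Real.norm_eq_abs, Real.norm_eq_abs, sq_abs, sq_abs]; ring
  simp only [hc, Finset.sum_add_distrib, mul_add]
  refine add_le_add (le_trans (le_of_eq ?_) hre2) (le_trans (le_of_eq ?_) him2)
  · refine Finset.sum_congr rfl fun i _ => ?_
    simp [Matrix.mulVec, dotProduct]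
  · refine Finset.sum_congr rfl fun i _ => ?_
    simp [Matrix.mulVec, dotProduct]

lemma U_norm_le {d : ℕ} (U : Matrix (Fin d) (Fin d) ℝ) (hU : U * Uᵀ = 1) : ‖U‖ ≤ 1 := by
  have h := Matrix.l2_opNorm_conjTranspose_mul_self U
  have e : Uᴴ * U = 1 := by
    rw [Matrix.conjTranspose_eq_transpose_of_trivial]; exact mul_eq_one_comm.1 hU
  rw [e] at h
  have h1 : ‖(1 : Matrix (Fin d) (Fin d) ℝ)‖ ≤ 1 := by
    rw [← Matrix.diagonal_one, Matrix.l2_opNorm_diagonal]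
    exact (pi_norm_le_iff_of_nonneg zero_le_one).2 fun i => by simp
  nlinarith [norm_nonneg U]

lemma lower_bound {d : ℕ} (α β ν : ℝ) (hα : 0 < α) (lam : Fin d → ℝ) (hpos : ∀ j, 0 < lam j)
    (U : Matrix (Fin d) (Fin d) ℝ) (hU : U * Uᵀ = 1)
    (Q : Matrix (Fin d) (Fin d) ℝ) (hQ : Q = U * Matrix.diagonal lam * Uᵀ)
    (Δ : Matrix (Fin d) (Fin d) ℂ) (z : ℂ) (hz : 1 ≤ ‖z‖) (κ : ℝ) (hκ : 0 ≤ κ)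
    (hb : ∀ j, ‖z‖ * (κ * Real.sqrt (lam j)) ≤ ‖z^2 + (bCoef α β ν (lam j) : ℝ)*z + (cCoef α β ν (lam j) : ℝ)‖)
    (hspec : z ∈ spectrum ℂ (AQc α β ν Q + Bc (d := d) α * Δ * Tc lam U)) :
    κ ≤ (α / Real.sqrt 2) * ‖Δ‖ := by
  obtain ⟨w, hw, h⟩ := (spec_char α β ν lam U hU Q hQ Δ z).1 hspec
  set v : EuclideanSpace ℂ (Fin d) := WithLp.toLp 2 (fun i => ((Real.sqrt (lam i) : ℝ) : ℂ) * w i) with hv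
  have hv0 : 0 < ‖v‖ := by
    rw [norm_pos_iff]
    intro h0
    apply hw
    ext i
    have : v i = 0 := by rw [h0]; rfl
    rw [hv] at this
    simp only at this
    rcases mul_eq_zero.1 this with h1 | h1
    · exact absurd (Complex.ofReal_eq_zero.1 h1) (Real.sqrt_pos.2 (hpos i)).ne'
    · exact h1
  have hz0 : 0 < ‖z‖ := by linarith
  set V := U.map Complex.ofReal with hV
  have hVn : ‖Vᵀ * Δ‖ ≤ ‖Δ‖ := by
    have h1 : ‖Vᵀ‖ ≤ 1 := by
      have : Vᵀ = Uᵀ.map Complex.ofReal := Matrix.transpose_map.symm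
      rw [this]
      exact (map_norm_le _).trans (U_norm_le _ (by rw [Matrix.transpose_transpose]; exact mul_eq_one_comm.1 hU))
    calc ‖Vᵀ * Δ‖ ≤ ‖Vᵀ‖ * ‖Δ‖ := Matrix.l2_opNorm_mul _ _
      _ ≤ 1 * ‖Δ‖ := by gcongr
      _ = ‖Δ‖ := one_mul _
  have hop := (Matrix.l2_opNorm_mulVec (Vᵀ * Δ) v).trans (mul_le_mul_of_nonneg_right hVn (norm_nonneg v))
  have hαs : 0 < α / Real.sqrt 2 := by positivity
  have hcoord : ∀ j, κ * ‖v j‖ ≤ (α / Real.sqrt 2) * ‖((Vᵀ * Δ) *ᵥ v) j‖ := by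
    intro j
    have h1 := congrArg norm (h j)
    rw [norm_mul, norm_mul, norm_mul, norm_neg, Complex.norm_real, Real.norm_eq_abs, abs_of_pos hαs] at h1
    have h2 := mul_le_mul_of_nonneg_right (hb j) (norm_nonneg (w j))
    rw [h1] at h2
    have h3 : ‖v j‖ = Real.sqrt (lam j) * ‖w j‖ := by
      rw [hv]; simp only
      rw [norm_mul, Complex.norm_real, Real.norm_eq_abs, abs_of_nonneg (Real.sqrt_nonneg _)]
    rw [h3]
    refine le_of_mul_le_mul_left ?_ hz0
    refine le_trans (le_of_eq (by ring)) (h2.trans (le_of_eq ?_))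
    rw [hv]; ring
  have hsum : (κ * ‖v‖)^2 ≤ ((α / Real.sqrt 2) * ‖(EuclideanSpace.equiv (Fin d) ℂ).symm ((Vᵀ * Δ) *ᵥ v)‖)^2 := by
    rw [mul_pow, mul_pow, EuclideanSpace.norm_sq_eq, EuclideanSpace.norm_sq_eq, Finset.mul_sum, Finset.mul_sum]
    refine Finset.sum_le_sum fun j _ => ?_
    have := pow_le_pow_left₀ (by positivity) (hcoord j) 2
    rw [mul_pow, mul_pow] at this
    exact this
  have h4 := le_of_sq_le_sq hsum (by positivity)
  have h5 := h4.trans (mul_le_mul_of_nonneg_left hop hαs.le)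
  rw [← mul_assoc] at h5
  exact le_of_mul_le_mul_right h5 hv0

/-- when `c_{λ_*} ≤ 0` or `|b_{λ_*}(1+c_{λ_*})| ≥ 4|c_{λ_*}|`, the real and
complex stability radii of the GMM system coincide and equal `1/H∞`. -/
theorem real_eq_complex_stability_radius (d : ℕ) (hd : 1 ≤ d) (μ L : ℝ)
    (hμ : 0 < μ) (hμL : μ < L) (α β ν : ℝ) (hα : 0 < α) (hβ : 0 ≤ β) (hν : 0 ≤ ν)
    (lam : Fin d → ℝ) (hlampos : ∀ j, 0 < lam j) (hlammono : Monotone lam)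
    (hlam0 : lam ⟨0, by omega⟩ = μ) (hlamtop : lam ⟨d - 1, by omega⟩ = L)
    (U : Matrix (Fin d) (Fin d) ℝ) (hU : U * Uᵀ = 1)
    (Q : Matrix (Fin d) (Fin d) ℝ) (hQ : Q = U * Matrix.diagonal lam * Uᵀ)
    (hρ : spectralRadius ℂ (AQc α β ν Q) < 1)
    (lamstar : ℝ) (hlamstar : lamstar = μ ∨ lamstar = L)
    (hlammax : Real.sqrt lamstar / rCoef α β ν lamstar =
      max (Real.sqrt μ / rCoef α β ν μ) (Real.sqrt L / rCoef α β ν L))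
    (hcase : cCoef α β ν lamstar ≤ 0 ∨
      4 * |cCoef α β ν lamstar| ≤ |bCoef α β ν lamstar * (1 + cCoef α β ν lamstar)|) :
    rReal α β ν Q lam U = rComplex α β ν Q lam U ∧
    rComplex α β ν Q lam U =
      1 / (α / Real.sqrt 2 *
        max (Real.sqrt μ / rCoef α β ν μ) (Real.sqrt L / rCoef α β ν L)) := by
  have hstab : ∀ j, ∀ z : ℂ, z^2 + (bCoef α β ν (lam j) : ℝ)*z + (cCoef α β ν (lam j) : ℝ) = 0 → ‖z‖ < 1 := by
    intro j z hz
    have hmem : z ∈ spectrum ℂ (AQc α β ν Q) := by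
      have := (spec_char α β ν lam U hU Q hQ 0 z).2 ⟨Pi.single j 1, by simp, fun i => by
        rw [Matrix.mul_zero, Matrix.zero_mulVec, Pi.zero_apply, mul_zero]
        by_cases hij : i = j
        · subst hij; rw [hz, zero_mul]
        · rw [Pi.single_eq_of_ne hij, mul_zero]⟩
      simpa using this
    have h1 : (‖z‖₊ : ENNReal) ≤ spectralRadius ℂ (AQc α β ν Q) :=
      le_iSup₂ (f := fun (k : ℂ) (_ : k ∈ spectrum ℂ (AQc α β ν Q)) => (‖k‖₊ : ENNReal)) z hmem
    have h2 := lt_of_le_of_lt h1 hρ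
    have h3 : ‖z‖₊ < 1 := by exact_mod_cast h2
    exact_mod_cast h3
  have hj0 : ∀ j, μ ≤ lam j := fun j => by
    rw [← hlam0]; exact hlammono (Fin.mk_le_of_le_val (Nat.zero_le _))
  have hjL : ∀ j, lam j ≤ L := fun j => by
    rw [← hlamtop]; exact hlammono (Fin.le_def.2 (by have := j.2; simp only; omega))
  have hstμ : ∀ z : ℂ, z^2 + (bCoef α β ν μ : ℝ)*z + (cCoef α β ν μ : ℝ) = 0 → ‖z‖ < 1 := by
    rw [← hlam0]; exact hstab _
  have hstL : ∀ z : ℂ, z^2 + (bCoef α β ν L : ℝ)*z + (cCoef α β ν L : ℝ) = 0 → ‖z‖ < 1 := by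
    rw [← hlamtop]; exact hstab _
  have hL : 0 < L := hμ.trans hμL
  have jμ := jury_aux _ _ hstμ
  have jL := jury_aux _ _ hstL
  have rμ := (rCoef_spec α β ν μ jμ.1 jμ.2).1
  have rL := (rCoef_spec α β ν L jL.1 jL.2).1
  obtain ⟨js, hjs⟩ : ∃ j, lam j = lamstar := by
    rcases hlamstar with h | h
    · exact ⟨_, hlam0.trans h.symm⟩
    · exact ⟨_, hlamtop.trans h.symm⟩
  have hls : 0 < lamstar := hjs ▸ hlampos js
  have hsts := hstab js
  rw [hjs] at hsts
  have js' := jury_aux _ _ hsts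
  have rs := (rCoef_spec α β ν lamstar js'.1 js'.2).1
  have hsq : 0 < Real.sqrt lamstar := Real.sqrt_pos.2 hls
  have hs2 : 0 < Real.sqrt 2 := by positivity
  have hmμ := le_max_left (Real.sqrt μ / rCoef α β ν μ) (Real.sqrt L / rCoef α β ν L)
  have hmL := le_max_right (Real.sqrt μ / rCoef α β ν μ) (Real.sqrt L / rCoef α β ν L)
  rw [← hlammax] at hmμ hmL ⊢
  have hlow : ∀ Δ : Matrix (Fin d) (Fin d) ℂ,
      1 ≤ spectralRadius ℂ (AQc α β ν Q + Bc (d := d) α * Δ * Tc lam U) →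
      1 / (α / Real.sqrt 2 * (Real.sqrt lamstar / rCoef α β ν lamstar)) ≤ ‖Δ‖ := by
    intro Δ hΔ
    haveI : Nonempty (Fin d ⊕ Fin d) := ⟨Sum.inl js⟩
    obtain ⟨z, hzs, hz⟩ := spectrum.exists_nnnorm_eq_spectralRadius (AQc α β ν Q + Bc (d := d) α * Δ * Tc lam U)
    rw [← hz] at hΔ
    have hz1 : 1 ≤ ‖z‖ := by
      have h3 : 1 ≤ ‖z‖₊ := by exact_mod_cast hΔ
      exact_mod_cast h3
    have hκ := lower_bound α β ν hα lam hlampos U hU Q hQ Δ z hz1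
      (rCoef α β ν lamstar / Real.sqrt lamstar) (by positivity) (fun j => by
        refine main_scalar α β ν μ L (lam j) hα hν hμ (hj0 j) (hjL j) ?_ _ (by positivity) ?_ ?_ z hz1
        · intro l hl
          simp only [Set.mem_insert_iff, Set.mem_singleton_iff] at hl
          rcases hl with h | h | h
          · rw [h]; exact hstμ
          · rw [h]; exact hstL
          · rw [h]; exact hstab j
        · rw [div_le_div_iff₀ rμ rs] at hmμ
          rw [div_mul_eq_mul_div, div_le_iff₀ hsq]; linarith
        · rw [div_le_div_iff₀ rL rs] at hmL
          rw [div_mul_eq_mul_div, div_le_iff₀ hsq]; linarith) hzs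
    rw [div_le_iff₀ (by positivity)]
    have h6 := mul_le_mul_of_nonneg_right hκ (by positivity : 0 ≤ Real.sqrt lamstar / rCoef α β ν lamstar)
    have h7 : rCoef α β ν lamstar / Real.sqrt lamstar * (Real.sqrt lamstar / rCoef α β ν lamstar) = 1 := by
      field_simp
    rw [h7] at h6
    linarith
  have hup : ∃ Δ : Matrix (Fin d) (Fin d) ℝ,
      ‖Δ‖ ≤ 1 / (α / Real.sqrt 2 * (Real.sqrt lamstar / rCoef α β ν lamstar)) ∧
      1 ≤ spectralRadius ℂ (AQc α β ν Q + Bc (d := d) α * (Δ.map Complex.ofReal) * Tc lam U) := by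
    have hr : rCoef α β ν lamstar = 1 + cCoef α β ν lamstar - |bCoef α β ν lamstar| := by
      have h1c : 0 < 1 + cCoef α β ν lamstar := lt_of_le_of_lt (abs_nonneg _) js'.2
      unfold rCoef
      rw [if_neg, abs_of_pos h1c, abs_of_pos (by linarith [js'.2])]
      rintro ⟨h1, h2⟩
      rcases hcase with h | h
      · linarith
      · rw [div_lt_one (by positivity)] at h2
        rw [abs_mul, abs_of_pos h1, abs_of_pos h1c] at h
        linarith
    obtain ⟨ε, hε, hεr⟩ : ∃ ε : ℝ, (ε = 1 ∨ ε = -1) ∧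
        ε^2 + bCoef α β ν lamstar * ε + cCoef α β ν lamstar = rCoef α β ν lamstar := by
      rcases abs_cases (bCoef α β ν lamstar) with ⟨h, _⟩ | ⟨h, _⟩
      · exact ⟨-1, Or.inr rfl, by rw [hr, h]; ring⟩
      · exact ⟨1, Or.inl rfl, by rw [hr, h]; ring⟩
    have hε2 : ε * ε = 1 := by rcases hε with h | h <;> rw [h] <;> norm_num
    have hεa : |ε| = 1 := by rcases hε with h | h <;> rw [h] <;> norm_num
    set R := 1 / (α / Real.sqrt 2 * (Real.sqrt lamstar / rCoef α β ν lamstar)) with hR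
    have hR0 : 0 < R := by positivity
    refine ⟨(-(ε * R)) • U, ?_, ?_⟩
    · rw [norm_smul, norm_neg, norm_mul, Real.norm_eq_abs, hεa, Real.norm_eq_abs, abs_of_pos hR0, one_mul]
      calc R * ‖U‖ ≤ R * 1 := by gcongr; exact U_norm_le U hU
        _ = R := mul_one R
    · have hmem : (ε : ℂ) ∈ spectrum ℂ (AQc α β ν Q + Bc (d := d) α * (((-(ε * R)) • U).map Complex.ofReal) * Tc lam U) := by
        refine (spec_char α β ν lam U hU Q hQ _ _).2 ⟨Pi.single js 1, by simp, fun i => ?_⟩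
        have hmap : ((-(ε * R)) • U).map Complex.ofReal = ((-(ε*R) : ℝ) : ℂ) • U.map Complex.ofReal := by
          ext i j; simp
        rw [hmap, Matrix.mul_smul, (Umap_mul U hU).2, Matrix.smul_mulVec, Matrix.one_mulVec, Pi.smul_apply, smul_eq_mul]
        by_cases hij : i = js
        · subst hij
          rw [Pi.single_eq_same, mul_one, mul_one, hjs]
          have hreal : ε^2 + bCoef α β ν lamstar * ε + cCoef α β ν lamstar =
              -(α / Real.sqrt 2) * ε * (-(ε*R) * Real.sqrt lamstar) := by
            rw [hεr]
            have : -(α / Real.sqrt 2) * ε * (-(ε*R) * Real.sqrt lamstar) = (ε*ε) * ((α / Real.sqrt 2) * Real.sqrt lamstar * R) := by ring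
            rw [this, hε2, hR]
            field_simp
          exact_mod_cast congrArg Complex.ofReal hreal
        · rw [Pi.single_eq_of_ne hij]; ring
      have h1 : (‖(ε:ℂ)‖₊ : ENNReal) ≤ spectralRadius ℂ (AQc α β ν Q + Bc (d := d) α * (((-(ε * R)) • U).map Complex.ofReal) * Tc lam U) :=
        le_iSup₂ (f := fun (k : ℂ) (_ : k ∈ spectrum ℂ (AQc α β ν Q + Bc (d := d) α * (((-(ε * R)) • U).map Complex.ofReal) * Tc lam U)) => (‖k‖₊ : ENNReal)) (ε : ℂ) hmem
      have h2 : ‖(ε:ℂ)‖₊ = 1 := by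
        apply NNReal.eq
        rw [coe_nnnorm, Complex.norm_real, Real.norm_eq_abs, hεa]; rfl
      rw [h2] at h1
      simpa using h1
  obtain ⟨Δ0, hn, hsp⟩ := hup
  have hC : rComplex α β ν Q lam U = 1 / (α / Real.sqrt 2 * (Real.sqrt lamstar / rCoef α β ν lamstar)) := by
    unfold rComplex
    apply le_antisymm
    · refine le_trans (csInf_le ⟨0, ?_⟩ ⟨Δ0.map Complex.ofReal, rfl, hsp⟩) ((map_norm_le Δ0).trans hn)
      rintro x ⟨Δ, rfl, _⟩; exact norm_nonneg _
    · refine le_csInf ⟨_, Δ0.map Complex.ofReal, rfl, hsp⟩ ?_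
      rintro x ⟨Δ, rfl, h⟩; exact hlow Δ h
  have hRe : rReal α β ν Q lam U = 1 / (α / Real.sqrt 2 * (Real.sqrt lamstar / rCoef α β ν lamstar)) := by
    unfold rReal
    apply le_antisymm
    · refine le_trans (csInf_le ⟨0, ?_⟩ ⟨Δ0, rfl, hsp⟩) hn
      rintro x ⟨Δ, rfl, _⟩; exact norm_nonneg _
    · refine le_csInf ⟨_, Δ0, rfl, hsp⟩ ?_
      rintro x ⟨Δ, rfl, h⟩; exact (hlow _ h).trans (map_norm_le Δ)
  exact ⟨hRe.trans hC.symm, hC⟩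
end
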